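/- arXiv:1205.0772 — 6 statements merged into one kernel-verified Lean document; each statement's English description precedes it below -/
import Mathlib

section
/- Let 𝓛 ⊂ ℤ^s be a lattice and I(𝓛) its lattice ideal. If binomials g_1,...,g_r generate I(𝓛), then 𝓛 equals the subgroup of ℤ^s generated by ĝ_1,...,ĝ_r. In particular, if L is a lattice ideal, there is a unique lattice 𝓛 with L = I(𝓛). -/
open MvPolynomial

noncomputable section

/-- View a function `Fin s → ℕ` as a finitely supported function (an exponent vector). -/
abbrev toFs {s : ℕ} (a : Fin s → ℕ) : Fin s →₀ ℕ := Finsupp.equivFunOnFinite.symm a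

/-- The coercion of an exponent vector to `ℤ`. -/
abbrev intVec {s : ℕ} (a : Fin s → ℕ) : Fin s → ℤ := fun i => (a i : ℤ)

/-- The lattice ideal `I(𝓛)` of a lattice `𝓛 ⊆ ℤ^s`, generated by the binomials
`t^{a⁺} - t^{a⁻}` for `a ∈ 𝓛`. -/
def latticeIdeal {s : ℕ} (K : Type*) [Field K] (𝓛 : AddSubgroup (Fin s → ℤ)) :
    Ideal (MvPolynomial (Fin s) K) :=
  Ideal.span {f | ∃ a ∈ 𝓛,
    f = monomial (toFs fun i => (a i).toNat) (1 : K) - monomial (toFs fun i => (-a i).toNat) 1}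

/-- A binomial `t^a - t^b`. -/
def IsBinomial {s : ℕ} {K : Type*} [Field K] (f : MvPolynomial (Fin s) K) : Prop :=
  ∃ a b : Fin s → ℕ, f = monomial (toFs a) (1 : K) - monomial (toFs b) 1

/-- The affine zero set `V(I) ⊆ 𝔸_K^s` of an ideal of `K[t_1, …, t_s]`. -/
def zeroSet {s : ℕ} {K : Type*} [Field K] (I : Ideal (MvPolynomial (Fin s) K)) :
    Set (Fin s → K) := {x | ∀ f ∈ I, eval x f = 0}

/-- The height of an ideal: the infimum of the heights of the primes containing it. -/
def idealHeight {R : Type*} [CommRing R] (I : Ideal R) : ℕ∞ :=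
  ⨅ p ∈ {p : PrimeSpectrum R | I ≤ p.asIdeal}, Order.height p

/-- The class of an exponent vector in `ℤ^s / M`. -/
def expClass {s : ℕ} (M : AddSubgroup (Fin s → ℤ)) :
    (Fin s →₀ ℕ) →+ (Fin s → ℤ) ⧸ M where
  toFun a := QuotientAddGroup.mk (fun i => (a i : ℤ))
  map_zero' := by
    have : (fun i => (((0 : Fin s →₀ ℕ) i : ℕ) : ℤ)) = 0 := by ext; simp
    rw [this]; rfl
  map_add' x y := by
    rw [← QuotientAddGroup.mk_add]
    congr 1

/-- The grading map `K[t] → K[ℤ^s / M]`. -/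
def gradeMap {s : ℕ} (K : Type*) [Field K] (M : AddSubgroup (Fin s → ℤ)) :
    MvPolynomial (Fin s) K →+* AddMonoidAlgebra K ((Fin s → ℤ) ⧸ M) :=
  AddMonoidAlgebra.mapDomainRingHom K (expClass M)

theorem gradeMap_monomial {s : ℕ} (K : Type*) [Field K] (M : AddSubgroup (Fin s → ℤ))
    (a : Fin s →₀ ℕ) :
    gradeMap K M (monomial a 1) = AddMonoidAlgebra.single (expClass M a) 1 :=
  AddMonoidAlgebra.mapDomain_single

theorem gradeMap_binomial {s : ℕ} (K : Type*) [Field K] (M : AddSubgroup (Fin s → ℤ))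
    (a b : Fin s → ℕ) :
    gradeMap K M (monomial (toFs a) 1 - monomial (toFs b) 1) = 0 ↔
      intVec a - intVec b ∈ M := by
  rw [map_sub, sub_eq_zero, gradeMap_monomial, gradeMap_monomial,
    AddMonoidAlgebra.single_left_inj one_ne_zero]
  rw [← neg_mem_iff, neg_sub, sub_eq_neg_add]
  exact QuotientAddGroup.eq

theorem intVec_toNat {s : ℕ} (c : Fin s → ℤ) :
    intVec (fun i => (c i).toNat) - intVec (fun i => (-c i).toNat) = c := by
  ext i
  simp only [intVec, Pi.sub_apply]
  omega

theorem le_of_latticeIdeal_le {s : ℕ} (K : Type*) [Field K] (L M : AddSubgroup (Fin s → ℤ))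
    (h : latticeIdeal K L ≤ RingHom.ker (gradeMap K M)) : L ≤ M := by
  intro c hc
  have := h (Ideal.subset_span ⟨c, hc, rfl⟩)
  rw [RingHom.mem_ker, gradeMap_binomial, intVec_toNat] at this
  exact this

theorem latticeIdeal_le_ker {s : ℕ} (K : Type*) [Field K] (L : AddSubgroup (Fin s → ℤ)) :
    latticeIdeal K L ≤ RingHom.ker (gradeMap K L) := by
  refine Ideal.span_le.2 ?_
  rintro f ⟨c, hc, rfl⟩
  rw [SetLike.mem_coe, RingHom.mem_ker, gradeMap_binomial, intVec_toNat]
  exact hc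

theorem lattice_determined_by_lattice_ideal {s r : ℕ} (K : Type*) [Field K]
    (𝓛 : AddSubgroup (Fin s → ℤ)) (a b : Fin r → Fin s → ℕ)
    (h : latticeIdeal K 𝓛 = Ideal.span (Set.range fun j =>
      monomial (toFs (a j)) (1 : K) - monomial (toFs (b j)) 1)) :
    𝓛 = AddSubgroup.closure (Set.range fun j => intVec (a j) - intVec (b j)) ∧
      ∀ 𝓛' 𝓛'' : AddSubgroup (Fin s → ℤ),
        latticeIdeal K 𝓛' = latticeIdeal K 𝓛'' → 𝓛' = 𝓛'' := by
  refine ⟨le_antisymm ?_ ?_, fun L M hLM => le_antisymm ?_ ?_⟩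
  · apply le_of_latticeIdeal_le K
    rw [h]
    refine Ideal.span_le.2 ?_
    rintro f ⟨j, rfl⟩
    rw [SetLike.mem_coe, RingHom.mem_ker, gradeMap_binomial]
    exact AddSubgroup.subset_closure ⟨j, rfl⟩
  · rw [AddSubgroup.closure_le]
    rintro f ⟨j, rfl⟩
    rw [SetLike.mem_coe, ← gradeMap_binomial K, ← RingHom.mem_ker]
    apply latticeIdeal_le_ker K
    rw [h]
    exact Ideal.subset_span ⟨j, rfl⟩
  · exact le_of_latticeIdeal_le K _ _ (hLM ▸ latticeIdeal_le_ker K M)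
  · exact le_of_latticeIdeal_le K _ _ (hLM ▸ latticeIdeal_le_ker K L)
end
end

section
/- Let I ⊂ S be a graded binomial ideal (graded with respect to a weight vector ω with positive integer entries). If V(I, t_i) = {0} for all i = 1,...,s, then the height of I is s - 1. -/
open MvPolynomial

noncomputable section

section Helpers

/-- The height of a prime does not decrease under extension to the polynomial ring. -/
theorem height_le_height_map_C {R : Type*} [CommRing R] (q : Ideal R) [hq : q.IsPrime] :
    q.height ≤ (q.map (Polynomial.C : R →+* Polynomial R)).height := by
  let φ : PrimeSpectrum R → PrimeSpectrum (Polynomial R) := fun x =>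
    ⟨Ideal.map Polynomial.C x.asIdeal, Ideal.isPrime_map_C_of_isPrime⟩
  have hφ : StrictMono φ := by
    intro x y hxy
    have hlt : x.asIdeal < y.asIdeal := hxy
    change Ideal.map Polynomial.C x.asIdeal < Ideal.map Polynomial.C y.asIdeal
    obtain ⟨hle, z, hzy, hzx⟩ := SetLike.lt_iff_le_and_exists.1 hlt
    refine SetLike.lt_iff_le_and_exists.2
      ⟨Ideal.map_mono hle, Polynomial.C z, Ideal.mem_map_of_mem _ hzy, fun h => hzx ?_⟩
    simpa using (Ideal.mem_map_C_iff.1 h 0)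
  have h := Order.height_le_height_apply_of_strictMono φ hφ ⟨q, hq⟩
  rw [← PrimeSpectrum.height_eq_orderHeight, ← PrimeSpectrum.height_eq_orderHeight] at h
  exact h

theorem le_height_of_pow_sub_mem {K : Type*} [Field K] (n : ℕ) :
    ∀ (p : Ideal (MvPolynomial (Fin (n + 1)) K)) [p.IsPrime],
      (∀ j, ∃ c d : ℕ, 0 < c ∧ (X j ^ c - X (Fin.last n) ^ d : MvPolynomial _ K) ∈ p) →
      (n : ℕ∞) ≤ p.height := by
  induction n with
  | zero => intro p _ _; simp
  | succ n ih =>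
    intro p hp h
    let e := (finSuccEquiv K (n + 1)).toRingEquiv
    let P : Ideal (Polynomial (MvPolynomial (Fin (n + 1)) K)) := p.comap e.symm
    have hP : P.IsPrime := Ideal.comap_isPrime _ _
    have hmem : ∀ f, f ∈ p → e f ∈ P := by
      intro f hf
      simpa [P] using hf
    have hE0 : e (X 0) = Polynomial.X := finSuccEquiv_X_zero
    have hES : ∀ j : Fin (n + 1), e (X j.succ) = Polynomial.C (X j) := fun j =>
      finSuccEquiv_X_succ
    have hht : P.height = p.height := e.symm.height_comap p
    let q : Ideal (MvPolynomial (Fin (n + 1)) K) := P.comap Polynomial.C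
    have hq : q.IsPrime := Ideal.comap_isPrime _ _
    have h1 : (n : ℕ∞) ≤ q.height := by
      apply ih
      intro j
      obtain ⟨c, d, hc, hcd⟩ := h j.succ
      refine ⟨c, d, hc, ?_⟩
      have h2 := hmem _ hcd
      rw [← Fin.succ_last, map_sub, map_pow, map_pow, hES, hES, ← map_pow, ← map_pow,
        ← map_sub] at h2
      exact h2
    have h2 : q.map Polynomial.C < P := by
      obtain ⟨c, d, hc, hcd⟩ := h 0
      refine SetLike.lt_iff_le_and_exists.2 ⟨Ideal.map_comap_le, _, hmem _ hcd, fun h3 => ?_⟩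
      rw [← Fin.succ_last, map_sub, map_pow, map_pow, hES, hE0, ← map_pow] at h3
      have h4 := Ideal.mem_map_C_iff.1 h3 c
      have h5 : (1 : MvPolynomial (Fin (n + 1)) K) ∈ q := by
        rw [Polynomial.coeff_sub, Polynomial.coeff_X_pow_self, Polynomial.coeff_C,
          if_neg hc.ne', sub_zero] at h4
        exact h4
      exact hq.ne_top ((Ideal.eq_top_iff_one _).2 h5)
    have hqp : (q.map (Polynomial.C : MvPolynomial (Fin (n + 1)) K →+* _)).IsPrime :=
      Ideal.isPrime_map_C_of_isPrime
    have h3 := Ideal.height_add_one_le_of_lt_of_isPrime h2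
    rw [← hht]
    push_cast
    exact le_trans (by gcongr; exact h1.trans (height_le_height_map_C q)) h3

variable {s : ℕ} {K : Type*} [Field K]

theorem indicator_argument (G : Set (MvPolynomial (Fin s) K))
    (hG : ∀ g ∈ G, IsBinomial g)
    (hV : ∀ i : Fin s, zeroSet (Ideal.span G ⊔ Ideal.span {X i}) = {0})
    (T : Fin s → Prop)
    (hT : ∀ a b : Fin s → ℕ, monomial (toFs a) (1 : K) - monomial (toFs b) 1 ∈ G →
      ((∀ j, a j ≠ 0 → T j) ↔ (∀ j, b j ≠ 0 → T j)))
    (i : Fin s) (hi : ¬ T i) (j : Fin s) : ¬ T j := by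
  classical
  intro hj
  let x : Fin s → K := fun k => if T k then 1 else 0
  have hmon : ∀ a : Fin s → ℕ, eval x (monomial (toFs a) (1 : K)) =
      if (∀ k, a k ≠ 0 → T k) then 1 else 0 := by
    intro a
    rw [eval_monomial, Finsupp.prod_fintype _ _ (by simp), one_mul]
    split_ifs with h
    · apply Finset.prod_eq_one
      intro k _
      by_cases hk : a k = 0
      · simp [hk]
      · simp [x, h k hk]
    · push Not at h
      obtain ⟨k, hk, hTk⟩ := h
      apply Finset.prod_eq_zero (Finset.mem_univ k)
      simp [x, hTk, hk]
  have hx : x ∈ zeroSet (Ideal.span G ⊔ Ideal.span {X i}) := by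
    have hle : Ideal.span G ⊔ Ideal.span {X i} ≤ RingHom.ker (eval x) := by
      refine sup_le (Ideal.span_le.2 ?_) (Ideal.span_le.2 ?_)
      · intro g hg
        obtain ⟨a, b, rfl⟩ := hG g hg
        have := hT a b hg
        change eval x _ = 0
        rw [map_sub, hmon, hmon, if_congr this rfl rfl, sub_self]
      · rintro _ rfl
        change eval x _ = 0
        simp [x, hi]
    exact fun f hf => hle hf
  rw [hV i] at hx
  have : x j = 0 := congrFun hx j
  simp [x, hj] at this

theorem weight_eq (w : Fin s → ℕ) (a b : Fin s → ℕ) (d : ℕ)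
    (h : IsWeightedHomogeneous w (monomial (toFs a) (1 : K) - monomial (toFs b) 1) d) :
    ∑ i, a i * w i = ∑ i, b i * w i := by
  classical
  by_cases hab : a = b
  · rw [hab]
  have hne : toFs a ≠ toFs b := fun h => hab (Finsupp.equivFunOnFinite.symm.injective h)
  have h1 := @h (toFs a) (by simp [coeff_monomial, hne.symm])
  have h2 := @h (toFs b) (by simp [coeff_monomial, hne])
  rw [Finsupp.weight_apply, Finsupp.sum_fintype _ _ (by simp)] at h1 h2
  simpa using h1.trans h2.symm

theorem functional_proportional (w : Fin s → ℕ) (hw : ∀ i, 0 < w i)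
    (G : Set (MvPolynomial (Fin s) K))
    (hG : ∀ g ∈ G, IsBinomial g ∧ ∃ d : ℕ, IsWeightedHomogeneous w g d)
    (hV : ∀ i : Fin s, zeroSet (Ideal.span G ⊔ Ideal.span {X i}) = {0})
    (v : Fin s → ℚ)
    (hv : ∀ a b : Fin s → ℕ, monomial (toFs a) (1 : K) - monomial (toFs b) 1 ∈ G →
      ∑ i, v i * a i = ∑ i, v i * b i) (j k : Fin s) :
    v j * w k = v k * w j := by
  have hwq : ∀ i, (0 : ℚ) < w i := fun i => by exact_mod_cast hw i
  obtain ⟨i, -, hi⟩ := Finset.exists_min_image Finset.univ (fun i => v i / w i)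
    ⟨j, Finset.mem_univ j⟩
  let u : Fin s → ℚ := fun l => v l * w i - v i * w l
  have hu0 : ∀ l, 0 ≤ u l := by
    intro l
    have := hi l (Finset.mem_univ l)
    rw [div_le_div_iff₀ (hwq i) (hwq l)] at this
    simp only [u]; linarith
  have key : ∀ a : Fin s → ℕ, (∀ l, a l ≠ 0 → u l = 0) ↔ ∑ l, u l * a l = 0 := by
    intro a
    rw [Finset.sum_eq_zero_iff_of_nonneg (fun l _ => mul_nonneg (hu0 l) (Nat.cast_nonneg _))]
    simp only [Finset.mem_univ, true_imp_iff, mul_eq_zero, Nat.cast_eq_zero]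
    exact forall_congr' fun l => by tauto
  have hall : ∀ l, u l = 0 := by
    intro l
    by_contra hl
    refine indicator_argument G (fun g hg => (hG g hg).1) hV (fun l => u l = 0) ?_ l hl i
      (by simp [u])
    intro a b hab
    rw [key, key]
    obtain ⟨-, d, hd⟩ := hG _ hab
    have h1 := weight_eq w a b d hd
    have h1q : ∑ l, (w l : ℚ) * a l = ∑ l, (w l : ℚ) * b l := by
      have : ((∑ i, a i * w i : ℕ) : ℚ) = (∑ i, b i * w i : ℕ) := by rw [h1]
      push_cast at this
      simpa [mul_comm] using this
    have h2 := hv a b hab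
    have hs : ∀ c : Fin s → ℕ, ∑ l, u l * c l =
        w i * (∑ l, v l * c l) - v i * ∑ l, (w l : ℚ) * c l := by
      intro c
      rw [Finset.mul_sum, Finset.mul_sum, ← Finset.sum_sub_distrib]
      exact Finset.sum_congr rfl fun l _ => by simp only [u]; ring
    rw [hs, hs, h1q, h2]
  have hj := hall j
  have hk := hall k
  simp only [u] at hj hk
  have : (w i : ℚ) * (v j * w k - v k * w j) = 0 := by linear_combination (w k : ℚ) * hj - (w j : ℚ) * hk
  rcases mul_eq_zero.1 this with h | h
  · exact absurd h (hwq i).ne'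
  · linarith

theorem exists_pow_sub_mem (w : Fin s → ℕ) (hw : ∀ i, 0 < w i)
    (G : Set (MvPolynomial (Fin s) K))
    (hG : ∀ g ∈ G, IsBinomial g ∧ ∃ d : ℕ, IsWeightedHomogeneous w g d)
    (hV : ∀ i : Fin s, zeroSet (Ideal.span G ⊔ Ideal.span {X i}) = {0})
    (p : Ideal (MvPolynomial (Fin s) K)) [hp : p.IsPrime] (hGp : Ideal.span G ≤ p)
    (j k : Fin s) :
    ∃ c d : ℕ, 0 < c ∧ (X j ^ c - X k ^ d : MvPolynomial _ K) ∈ p := by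
  classical
  have hmonX : ∀ a : Fin s → ℕ, monomial (toFs a) (1 : K) = ∏ l, X l ^ a l := by
    intro a
    rw [monomial_eq, Finsupp.prod_fintype _ _ (by simp)]
    simp
  by_cases hX : ∃ i, X i ∈ p
  · obtain ⟨i, hi⟩ := hX
    have hall : ∀ l, X l ∈ p := by
      intro l
      have hmp : ∀ a : Fin s → ℕ,
          (∀ l, a l ≠ 0 → X l ∉ p) ↔ monomial (toFs a) (1 : K) ∉ p := by
        intro a
        rw [hmonX, hp.prod_mem_iff]
        push Not
        simp only [Finset.mem_univ, true_imp_iff]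
        refine forall_congr' fun l => ?_
        constructor
        · intro h h'
          by_cases ha : a l = 0
          · rw [ha, pow_zero] at h'
            exact hp.ne_top ((Ideal.eq_top_iff_one _).2 h')
          · exact h ha (hp.mem_of_pow_mem _ h')
        · intro h ha h'
          exact h (Ideal.pow_mem_of_mem _ h' _ (Nat.pos_of_ne_zero ha))
      have := indicator_argument G (fun g hg => (hG g hg).1) hV (fun l => X l ∉ p) ?_ i
        (not_not.2 hi) l
      · exact not_not.1 this
      · intro a b hab
        rw [hmp, hmp]
        have hmem := hGp (Ideal.subset_span hab)
        exact not_congr ⟨fun h => by simpa using p.sub_mem h hmem,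
          fun h => by simpa using p.add_mem hmem h⟩
    exact ⟨1, 1, one_pos, by simpa using p.sub_mem (hall j) (hall k)⟩
  · push Not at hX
    let F := FractionRing (MvPolynomial (Fin s) K ⧸ p)
    let π : MvPolynomial (Fin s) K →+* F :=
      (algebraMap (MvPolynomial (Fin s) K ⧸ p) F).comp (Ideal.Quotient.mk p)
    have hπ : ∀ f, π f = 0 ↔ f ∈ p := by
      intro f
      simp only [π, RingHom.comp_apply]
      rw [FaithfulSMul.algebraMap_eq_zero_iff, Ideal.Quotient.eq_zero_iff_mem]
    let x : Fin s → F := fun l => π (X l)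
    have hx : ∀ l, x l ≠ 0 := fun l h => hX l ((hπ _).1 h)
    let L : Submodule ℚ (Fin s → ℚ) := Submodule.span ℚ
      {y | ∃ a b : Fin s → ℕ, monomial (toFs a) (1 : K) - monomial (toFs b) 1 ∈ G ∧
        y = fun l => (a l : ℚ) - b l}
    have hL : ∀ y ∈ L, ∃ (N : ℕ) (z : Fin s → ℤ), 0 < N ∧ (∀ l, (N : ℚ) * y l = z l) ∧
        ∏ l, x l ^ z l = 1 := by
      intro y hy
      induction hy using Submodule.span_induction with
      | mem y hy =>
        obtain ⟨a, b, hab, rfl⟩ := hy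
        refine ⟨1, fun l => (a l : ℤ) - b l, one_pos, fun l => by simp, ?_⟩
        have h1 := (hπ _).2 (hGp (Ideal.subset_span hab))
        rw [map_sub, hmonX, hmonX, map_prod, map_prod, sub_eq_zero] at h1
        simp only [map_pow] at h1
        have h2 : ∏ l, x l ^ b l ≠ 0 := Finset.prod_ne_zero_iff.2 fun l _ => pow_ne_zero _ (hx l)
        simp only [zpow_sub₀ (hx _), zpow_natCast]
        rw [Finset.prod_div_distrib]
        exact (div_eq_one_iff_eq h2).2 h1
      | zero => exact ⟨1, 0, one_pos, by simp, by simp⟩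
      | add y y' _ _ h h' =>
        obtain ⟨N, z, hN, hz, hxz⟩ := h
        obtain ⟨N', z', hN', hz', hxz'⟩ := h'
        refine ⟨N * N', fun l => z l * N' + z' l * N, Nat.mul_pos hN hN', fun l => ?_, ?_⟩
        · push_cast
          rw [← hz, ← hz', Pi.add_apply]; ring
        · simp only [zpow_add₀ (hx _), zpow_mul, zpow_natCast]
          rw [Finset.prod_mul_distrib, Finset.prod_pow, Finset.prod_pow, hxz, hxz']
          simp
      | smul r y _ h =>
        obtain ⟨N, z, hN, hz, hxz⟩ := h
        refine ⟨N * r.den, fun l => z l * r.num, Nat.mul_pos hN r.den_pos, fun l => ?_, ?_⟩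
        · push_cast
          rw [← hz, Pi.smul_apply, smul_eq_mul]
          have := Rat.den_mul_eq_num r
          linear_combination (N : ℚ) * y l * this
        · simp only [zpow_mul]
          rw [Finset.prod_zpow, hxz, one_zpow]
    have hmemL : (Pi.single j (w k : ℚ) - Pi.single k (w j : ℚ) : Fin s → ℚ) ∈ L := by
      by_contra hn
      obtain ⟨f, hf, hLf⟩ := Submodule.exists_le_ker_of_notMem hn
      apply hf
      have hfe : ∀ y : Fin s → ℚ, f y = ∑ l, f (Pi.single l 1) * y l := by
        intro y
        rw [LinearMap.pi_apply_eq_sum_univ f y]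
        refine Finset.sum_congr rfl fun l _ => ?_
        rw [smul_eq_mul, mul_comm]
        congr 2
        ext m
        simp [Pi.single_apply, eq_comm]
      have := functional_proportional w hw G hG hV (fun l => f (Pi.single l 1)) ?_ j k
      · rw [map_sub, hfe, hfe (Pi.single k _)]
        simp [Pi.single_apply, this]
      · intro a b hab
        have h1 : f (fun l => (a l : ℚ) - b l) = 0 :=
          hLf (Submodule.subset_span ⟨a, b, hab, rfl⟩)
        rw [hfe] at h1
        simp only [mul_sub, Finset.sum_sub_distrib] at h1
        exact sub_eq_zero.1 h1
    by_cases hjk : j = k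
    · exact ⟨1, 1, one_pos, by simp [hjk]⟩
    obtain ⟨N, z, hN, hz, hxz⟩ := hL _ hmemL
    refine ⟨N * w k, N * w j, Nat.mul_pos hN (hw k), ?_⟩
    have hzj : z j = (N * w k : ℕ) := by
      have := hz j
      simp [hjk] at this
      exact_mod_cast this.symm
    have hzk : z k = -(N * w j : ℕ) := by
      have := hz k
      simp [Ne.symm hjk] at this
      have h : (z k : ℚ) = ((-(N * w j : ℕ) : ℤ) : ℚ) := by push_cast; linarith
      exact_mod_cast h
    have hzl : ∀ l, l ≠ j ∧ l ≠ k → x l ^ z l = 1 := by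
      rintro l ⟨h1, h2⟩
      have := hz l
      simp [h1, h2] at this
      have h0 : z l = 0 := by exact_mod_cast this.symm
      rw [h0, zpow_zero]
    rw [Fintype.prod_eq_mul j k hjk hzl, hzj, hzk, zpow_neg, zpow_natCast, zpow_natCast] at hxz
    rw [← hπ, map_sub, map_pow, map_pow, sub_eq_zero]
    exact (mul_inv_eq_one₀ (pow_ne_zero _ (hx k))).1 hxz

theorem exists_prime_lt (w : Fin s → ℕ) (hw : ∀ i, 0 < w i)
    (G : Set (MvPolynomial (Fin s) K))
    (hG : ∀ g ∈ G, IsBinomial g ∧ ∃ d : ℕ, IsWeightedHomogeneous w g d) :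
    ∃ P : PrimeSpectrum (MvPolynomial (Fin s) K), Ideal.span G ≤ P.asIdeal ∧
      P.asIdeal.height ≤ (s - 1 : ℕ) := by
  let φ : MvPolynomial (Fin s) K →ₐ[K] Polynomial K := aeval fun i => Polynomial.X ^ w i
  let ε : Polynomial K →ₐ[K] K := Polynomial.aeval 0
  let P : Ideal (MvPolynomial (Fin s) K) := RingHom.ker φ
  let M : Ideal (MvPolynomial (Fin s) K) := RingHom.ker (ε.comp φ)
  have hP : P.IsPrime := RingHom.ker_isPrime _
  have hM : M.IsPrime := RingHom.ker_isPrime _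
  have hdim : ∀ Q : Ideal (MvPolynomial (Fin s) K), Q.IsPrime → Q.height ≤ (s : ℕ) := by
    intro Q hQ
    have h := Ideal.height_le_ringKrullDim_of_isPrime (I := Q)
    rw [MvPolynomial.ringKrullDim_of_isNoetherianRing, ringKrullDim_eq_zero_of_field] at h
    simp only [Nat.card_eq_fintype_card, Fintype.card_fin, zero_add] at h
    exact_mod_cast h
  refine ⟨⟨P, hP⟩, Ideal.span_le.2 ?_, ?_⟩
  · intro g hg
    obtain ⟨⟨a, b, rfl⟩, d, hd⟩ := hG g hg
    have h1 := weight_eq w a b d hd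
    have h2 : ∀ a : Fin s → ℕ, φ (monomial (toFs a) (1 : K)) =
        Polynomial.X ^ (∑ i, a i * w i) := by
      intro a
      simp only [φ]
      rw [aeval_monomial, Finsupp.prod_fintype _ _ (by simp), map_one, one_mul,
        ← Finset.prod_pow_eq_pow_sum]
      exact Finset.prod_congr rfl fun i _ => by simp [← pow_mul, mul_comm]
    change φ _ = 0
    rw [map_sub, h2, h2, h1, sub_self]
  · change P.height ≤ _
    rcases s with _ | n
    · exact hdim P hP
    · have hlt : P < M := by
        refine SetLike.lt_iff_le_and_exists.2 ⟨fun f hf => ?_, X 0, ?_, ?_⟩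
        · have hf' : φ f = 0 := hf
          change ε (φ f) = 0
          rw [hf', map_zero]
        · change ε (φ (X 0)) = 0
          simp [φ, ε, (hw 0).ne']
        · change ¬ (φ (X 0) = 0)
          simp [φ]
      have h := (Ideal.height_add_one_le_of_lt_of_isPrime hlt).trans (hdim M hM)
      push_cast at h
      simpa using (ENat.add_le_add_iff_right (ENat.natCast_ne_top 1)).1 h

end Helpers

theorem graded_binomial_ideal_height {s : ℕ} {K : Type*} [Field K]
    (w : Fin s → ℕ) (hw : ∀ i, 0 < w i)
    (I : Ideal (MvPolynomial (Fin s) K)) (G : Set (MvPolynomial (Fin s) K))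
    (hG : ∀ g ∈ G, IsBinomial g ∧ ∃ d : ℕ, IsWeightedHomogeneous w g d)
    (hI : I = Ideal.span G)
    (hV : ∀ i : Fin s, zeroSet (I ⊔ Ideal.span {X i}) = {0}) :
    idealHeight I = (s - 1 : ℕ) := by
  subst hI
  unfold idealHeight
  apply le_antisymm
  · obtain ⟨P, hP, hh⟩ := exists_prime_lt w hw G hG
    rw [PrimeSpectrum.height_eq_orderHeight] at hh
    exact (iInf₂_le P hP).trans hh
  · refine le_iInf₂ fun p hp => ?_
    rw [← PrimeSpectrum.height_eq_orderHeight]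
    rcases s with _ | n
    · simp
    · exact le_height_of_pow_sub_mem n p.asIdeal fun j =>
        exists_pow_sub_mem w hw G hG hV p.asIdeal hp j (Fin.last n)
end
end

section
/- Let I be a graded lattice ideal in S (graded with respect to a positive weight vector ω). If the height of I equals s - 1, then V(I, t_i) = {0} for every i = 1,...,s. More precisely, for every pair of distinct indices i, k there exist positive integers r_i, r_k with r_i ω_i = r_k ω_k and t_i^{r_i} - t_k^{r_k} ∈ I. -/
open MvPolynomial

noncomputable section

lemma sum_toNat_eq {s : ℕ} (u : Fin s → ℕ) (a : Fin s → ℤ) (h : ∑ i, a i * (u i : ℤ) = 0) :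
    ∑ i, u i * (a i).toNat = ∑ i, u i * (-a i).toNat := by
  zify
  rw [← sub_eq_zero, ← Finset.sum_sub_distrib, ← h]
  refine Finset.sum_congr rfl fun i _ => ?_
  rw [← mul_sub, mul_comm]
  congr 1
  have := Int.toNat_sub_toNat_neg (a i)
  exact this

lemma latticeIdeal_le_ker_s7 {s : ℕ} {K R : Type*} [Field K] [CommRing R] [Algebra K R]
    (𝓛 : AddSubgroup (Fin s → ℤ)) (w v : Fin s → ℕ) (x y : R)
    (hw : ∀ a ∈ 𝓛, ∑ i, a i * (w i : ℤ) = 0) (hv : ∀ a ∈ 𝓛, ∑ i, a i * (v i : ℤ) = 0) :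
    latticeIdeal K 𝓛 ≤
      RingHom.ker (aeval (fun i => x ^ w i * y ^ v i) : MvPolynomial (Fin s) K →ₐ[K] R) := by
  rw [latticeIdeal, Ideal.span_le]
  rintro f ⟨a, ha, rfl⟩
  have key : ∀ b : Fin s → ℕ, aeval (fun i => x ^ w i * y ^ v i) (monomial (toFs b) (1 : K)) =
      x ^ (∑ i, w i * b i) * y ^ (∑ i, v i * b i) := by
    intro b
    rw [aeval_monomial, Finsupp.prod_fintype _ _ (by simp)]
    simp [mul_pow, Finset.prod_mul_distrib, ← pow_mul, Finset.prod_pow_eq_pow_sum]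
  simp only [SetLike.mem_coe, RingHom.mem_ker, map_sub, key]
  rw [sum_toNat_eq w a (hw a ha), sum_toNat_eq v a (hv a ha), sub_self]

lemma mem_of_mul {s : ℕ} {K : Type*} [Field K] (𝓛 : AddSubgroup (Fin s → ℤ))
    (i k : Fin s) (hik : i ≠ k) (p q : ℕ)
    (h : (Pi.single i (p : ℤ) - Pi.single k (q : ℤ) : Fin s → ℤ) ∈ 𝓛) :
    (X i ^ p - X k ^ q : MvPolynomial (Fin s) K) ∈ latticeIdeal K 𝓛 := by
  apply Ideal.subset_span
  refine ⟨_, h, ?_⟩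
  rw [X_pow_eq_monomial, X_pow_eq_monomial]
  congr 3
  · ext j
    by_cases h1 : j = i
    · subst h1; simp [hik]
    · by_cases h2 : j = k
      · subst h2; simp [h1, hik]
      · simp [h1, h2]
  · ext j
    by_cases h1 : j = i
    · subst h1; simp [hik]
    · by_cases h2 : j = k
      · subst h2; simp [h1, hik]
      · simp [h1, h2]

/-- The rational saturation of a lattice. -/
def ratSpan {s : ℕ} (𝓛 : AddSubgroup (Fin s → ℤ)) : Submodule ℚ (Fin s → ℚ) where
  carrier := {x | ∃ m : ℤ, m ≠ 0 ∧ ∃ a ∈ 𝓛, ∀ i, (m : ℚ) * x i = a i}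
  zero_mem' := ⟨1, one_ne_zero, 0, 𝓛.zero_mem, by simp⟩
  add_mem' := by
    rintro x y ⟨m, hm, a, ha, hx⟩ ⟨n, hn, b, hb, hy⟩
    refine ⟨m * n, mul_ne_zero hm hn, n • a + m • b,
      𝓛.add_mem (𝓛.zsmul_mem ha _) (𝓛.zsmul_mem hb _), fun i => ?_⟩
    simp only [Pi.add_apply, Pi.smul_apply, smul_eq_mul]
    push_cast
    rw [← hx, ← hy]; ring
  smul_mem' := by
    rintro c x ⟨m, hm, a, ha, hx⟩
    refine ⟨m * c.den, mul_ne_zero hm (by exact_mod_cast c.den_nz), c.num • a,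
      𝓛.zsmul_mem ha _, fun i => ?_⟩
    simp only [Pi.smul_apply, smul_eq_mul]
    push_cast
    rw [← hx, ← Rat.mul_den_eq_num c]; ring

lemma exists_weight {s : ℕ} (w : Fin s → ℕ) (hw : ∀ i, 0 < w i)
    (𝓛 : AddSubgroup (Fin s → ℤ)) (hhom : ∀ a ∈ 𝓛, ∑ i, a i * (w i : ℤ) = 0)
    (i k : Fin s)
    (h : ∀ m : ℤ, m ≠ 0 →
      m • (Pi.single i (w k : ℤ) - Pi.single k (w i : ℤ) : Fin s → ℤ) ∉ 𝓛) :
    ∃ v : Fin s → ℕ, (∀ a ∈ 𝓛, ∑ i, a i * (v i : ℤ) = 0) ∧ w k * v i ≠ w i * v k := by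
  have he : (Pi.single i (w k : ℚ) - Pi.single k (w i : ℚ) : Fin s → ℚ) ∉ ratSpan 𝓛 := by
    rintro ⟨m, hm, a, ha, hx⟩
    refine h m hm ?_
    convert ha
    ext j
    have := hx j
    simp only [Pi.sub_apply, Pi.single_apply, Pi.smul_apply, smul_eq_mul] at this ⊢
    exact_mod_cast this
  obtain ⟨f, hf, hle⟩ := Submodule.exists_le_ker_of_notMem he
  have hfx : ∀ x, f x = ∑ j, x j * f (Pi.single j 1) := by
    intro x
    conv_lhs => rw [pi_eq_sum_univ' x]
    simp [map_sum]
  obtain ⟨D, hD⟩ := IsLocalization.exist_integer_multiples_of_finite (nonZeroDivisors ℤ)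
    (fun j => f (Pi.single j 1))
  have hD0 : ((D : ℤ) : ℚ) ≠ 0 := by
    exact_mod_cast nonZeroDivisors.coe_ne_zero D
  choose u hu using hD
  simp only [algebraMap_int_eq, eq_intCast, Submonoid.smul_def, zsmul_eq_mul] at hu
  have hu𝓛 : ∀ a ∈ 𝓛, ∑ i, a i * u i = 0 := by
    intro a ha
    have h0 : f (fun j => (a j : ℚ)) = 0 := hle (show _ ∈ ratSpan 𝓛 from
      ⟨1, one_ne_zero, a, ha, by simp⟩)
    rw [hfx] at h0
    have : ((∑ i, a i * u i : ℤ) : ℚ) = 0 := by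
      push_cast
      simp only [hu]
      rw [← mul_zero ((D : ℤ) : ℚ), ← h0, Finset.mul_sum]
      exact Finset.sum_congr rfl fun j _ => by ring
    exact_mod_cast this
  have hne : (w k : ℤ) * u i ≠ w i * u k := by
    intro h1
    apply hf
    have h2 : (w k : ℚ) * u i = w i * u k := by exact_mod_cast h1
    rw [hu, hu] at h2
    have h3 : ∀ (j : Fin s) (c : ℚ), f (Pi.single j c) = c * f (Pi.single j 1) := by
      intro j c
      rw [← smul_eq_mul, ← map_smul, ← Pi.single_smul, smul_eq_mul, mul_one]
    rw [map_sub, h3, h3 k]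
    apply mul_left_cancel₀ hD0
    linear_combination h2
  set N : ℤ := ∑ j, |u j| with hN
  have hpos : ∀ j, 0 ≤ u j + N * w j := by
    intro j
    have h1 : |u j| ≤ N := Finset.single_le_sum (f := fun j => |u j|)
      (fun _ _ => abs_nonneg _) (Finset.mem_univ j)
    have h2 := neg_abs_le (u j)
    have h3 : (1 : ℤ) ≤ w j := by exact_mod_cast hw j
    nlinarith [abs_nonneg (u j)]
  have hc : ∀ j, ((u j + N * w j).toNat : ℤ) = u j + N * w j := fun j =>
    Int.toNat_of_nonneg (hpos j)
  refine ⟨fun j => (u j + N * w j).toNat, fun a ha => ?_, fun h1 => hne ?_⟩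
  · simp only [hc, mul_add, Finset.sum_add_distrib, hu𝓛 a ha, zero_add]
    rw [← mul_zero N, ← hhom a ha, Finset.mul_sum]
    exact Finset.sum_congr rfl fun j _ => by ring
  · zify at h1
    rw [hc, hc] at h1
    linear_combination h1

lemma height_le {s : ℕ} {K : Type*} [Field K] (w : Fin s → ℕ) (hw : ∀ i, 0 < w i)
    (𝓛 : AddSubgroup (Fin s → ℤ)) (hhom : ∀ a ∈ 𝓛, ∑ i, a i * (w i : ℤ) = 0)
    (i k : Fin s) (v : Fin s → ℕ)
    (hv : ∀ a ∈ 𝓛, ∑ i, a i * (v i : ℤ) = 0) (hne : w k * v i ≠ w i * v k) :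
    idealHeight (latticeIdeal K 𝓛) + 2 ≤ (s : ℕ∞) := by
  let φ : MvPolynomial (Fin s) K →ₐ[K] Polynomial (Polynomial K) :=
    aeval fun j => (Polynomial.C Polynomial.X) ^ w j * Polynomial.X ^ v j
  let ψ : MvPolynomial (Fin s) K →ₐ[K] Polynomial K := aeval fun j => Polynomial.X ^ w j
  let χ : MvPolynomial (Fin s) K →ₐ[K] K := aeval fun _ => 0
  have h1 : ∀ f, ψ f = Polynomial.evalRingHom (1 : Polynomial K) (φ f) := by
    intro f
    have : (ψ : MvPolynomial (Fin s) K →+* Polynomial K) =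
        (Polynomial.evalRingHom (1 : Polynomial K)).comp (φ : _ →+* _) := by
      apply MvPolynomial.ringHom_ext
      · intro r; simp [ψ, φ]
      · intro j; simp [ψ, φ]
    exact congrArg (fun g => g f) this
  have h2 : ∀ f, χ f = Polynomial.evalRingHom (0 : K) (ψ f) := by
    intro f
    have : (χ : MvPolynomial (Fin s) K →+* K) =
        (Polynomial.evalRingHom (0 : K)).comp (ψ : _ →+* _) := by
      apply MvPolynomial.ringHom_ext
      · intro r; simp [ψ, χ]
      · intro j; simp [ψ, χ, (hw j).ne']
    exact congrArg (fun g => g f) this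
  let P : PrimeSpectrum (MvPolynomial (Fin s) K) := ⟨RingHom.ker φ, RingHom.ker_isPrime _⟩
  let P' : PrimeSpectrum (MvPolynomial (Fin s) K) := ⟨RingHom.ker ψ, RingHom.ker_isPrime _⟩
  let P'' : PrimeSpectrum (MvPolynomial (Fin s) K) := ⟨RingHom.ker χ, RingHom.ker_isPrime _⟩
  have hlt1 : P < P' := by
    rw [← PrimeSpectrum.asIdeal_lt_asIdeal]
    refine SetLike.lt_iff_le_and_exists.2 ⟨fun f hf => ?_,
      X i ^ w k - X k ^ w i, ?_, ?_⟩
    · have hf : φ f = 0 := hf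
      change ψ f = 0
      rw [h1, hf, map_zero]
    · change ψ _ = 0
      simp [ψ, ← pow_mul, mul_comm (w i)]
    · intro hf
      have hf : φ _ = 0 := hf
      simp only [φ, map_sub, map_pow, aeval_X, mul_pow, ← pow_mul, mul_comm (w i) (w k)] at hf
      rw [← mul_sub] at hf
      rcases mul_eq_zero.1 hf with h | h
      · exact pow_ne_zero _ (by simp) h
      · rw [sub_eq_zero] at h
        have := congrArg Polynomial.natDegree h
        simp only [Polynomial.natDegree_X_pow] at this
        exact hne (by linarith)
  have hlt2 : P' < P'' := by
    rw [← PrimeSpectrum.asIdeal_lt_asIdeal]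
    refine SetLike.lt_iff_le_and_exists.2 ⟨fun f hf => ?_, X i, ?_, ?_⟩
    · have hf : ψ f = 0 := hf
      change χ f = 0
      rw [h2, hf, map_zero]
    · change χ _ = 0
      simp [χ]
    · intro hf
      have hf : ψ _ = 0 := hf
      simp [ψ] at hf
  have hL : latticeIdeal K 𝓛 ≤ P.asIdeal := latticeIdeal_le_ker_s7 𝓛 w v _ _ hhom hv
  have hle : idealHeight (latticeIdeal K 𝓛) ≤ Order.height P := iInf₂_le P hL
  have e1 := Order.height_add_one_le hlt1
  have e2 := Order.height_add_one_le hlt2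
  have e3 : Order.height P'' ≤ (s : ℕ∞) := by
    have h := Order.height_le_krullDim P''
    have hd : Order.krullDim (PrimeSpectrum (MvPolynomial (Fin s) K)) = (s : WithBot ℕ∞) := by
      have := MvPolynomial.ringKrullDim_of_isNoetherianRing (R := K) (ι := Fin s)
      rw [ringKrullDim_eq_zero_of_field, zero_add, Nat.card_fin] at this
      exact this
    rw [hd] at h
    exact_mod_cast h
  calc _ ≤ Order.height P + 2 := by gcongr
    _ = Order.height P + 1 + 1 := by rw [add_assoc]; rfl
    _ ≤ Order.height P' + 1 := by gcongr
    _ ≤ _ := e2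
    _ ≤ _ := e3

theorem graded_lattice_ideal_height_imp_zero_sets {s : ℕ} {K : Type*} [Field K]
    (w : Fin s → ℕ) (hw : ∀ i, 0 < w i)
    (𝓛 : AddSubgroup (Fin s → ℤ)) (hhom : ∀ a ∈ 𝓛, ∑ i, a i * (w i : ℤ) = 0)
    (L : Ideal (MvPolynomial (Fin s) K)) (hL : L = latticeIdeal K 𝓛)
    (hht : idealHeight L = (s - 1 : ℕ)) :
    (∀ i : Fin s, zeroSet (L ⊔ Ideal.span {X i}) = {0}) ∧
      ∀ i k : Fin s, i ≠ k → ∃ ri rk : ℕ, 0 < ri ∧ 0 < rk ∧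
        ri * w i = rk * w k ∧ X i ^ ri - X k ^ rk ∈ L := by
  have main : ∀ i k : Fin s, i ≠ k → ∃ ri rk : ℕ, 0 < ri ∧ 0 < rk ∧
        ri * w i = rk * w k ∧ X i ^ ri - X k ^ rk ∈ L := by
    intro i k hik
    have hex : ∃ m : ℤ, m ≠ 0 ∧
        m • (Pi.single i (w k : ℤ) - Pi.single k (w i : ℤ) : Fin s → ℤ) ∈ 𝓛 := by
      by_contra! hcon
      obtain ⟨v, hv, hne⟩ := exists_weight w hw 𝓛 hhom i k hcon
      have := height_le (K := K) w hw 𝓛 hhom i k v hv hne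
      rw [← hL, hht] at this
      have h3 : s - 1 + 2 ≤ s := by exact_mod_cast this
      omega
    obtain ⟨m, hm, hmem⟩ := hex
    have hmem' : (m.natAbs : ℤ) •
        (Pi.single i (w k : ℤ) - Pi.single k (w i : ℤ) : Fin s → ℤ) ∈ 𝓛 := by
      rcases Int.natAbs_eq m with h | h
      · rwa [← h]
      · rw [show (m.natAbs : ℤ) = -m by omega, neg_smul]
        exact 𝓛.neg_mem hmem
    have hp : 0 < m.natAbs := Int.natAbs_pos.2 hm
    refine ⟨m.natAbs * w k, m.natAbs * w i, Nat.mul_pos hp (hw k), Nat.mul_pos hp (hw i),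
      by ring, ?_⟩
    rw [hL]
    apply mem_of_mul _ _ _ hik
    convert hmem' using 1
    rw [smul_sub, ← Pi.single_smul, ← Pi.single_smul]
    push_cast
    rfl
  refine ⟨fun i => ?_, main⟩
  ext x
  simp only [Set.mem_singleton_iff]
  constructor
  · intro hx
    have hi : x i = 0 := by
      simpa using hx (X i) (Ideal.mem_sup_right (Ideal.mem_span_singleton_self _))
    ext k
    by_cases hik : i = k
    · subst hik; exact hi
    · obtain ⟨ri, rk, h1, h2, -, h3⟩ := main i k hik
      have := hx _ (Ideal.mem_sup_left h3)
      simp only [map_sub, map_pow, eval_X, hi, zero_pow h1.ne', zero_sub, neg_eq_zero] at this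
      exact eq_zero_of_pow_eq_zero this
  · rintro rfl f hf
    have hle : L ⊔ Ideal.span {X i} ≤ RingHom.ker (eval (0 : Fin s → K)) := by
      refine sup_le ?_ ?_
      · rw [hL]
        intro g hg
        have := latticeIdeal_le_ker_s7 (K := K) (R := K) 𝓛 w w 0 1 hhom hhom hg
        rw [RingHom.mem_ker] at this ⊢
        rw [← this, ← MvPolynomial.coe_aeval_eq_eval]
        simp only [RingHom.coe_coe]
        congr 2
        ext j
        simp [(hw j).ne']
      · rw [Ideal.span_singleton_le_iff_mem, RingHom.mem_ker]
        simp
    exact hle hf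
end
end

section
/- Let I ⊂ S be a graded binomial ideal with V(I, t_i) = {0} for all i. If I is a complete intersection (generated by ht(I) = s - 1 elements), then I is a lattice ideal; equivalently, every variable t_i is a non-zerodivisor on S/I. -/
open MvPolynomial

noncomputable section

section LocalPart

open IsLocalRing

/-- `x` is a non-zerodivisor modulo `J`. -/
def NZmod {R : Type*} [CommRing R] (J : Ideal R) (x : R) : Prop := ∀ a, x * a ∈ J → a ∈ J

/-- The depth of `R/J` is at least `n`. -/
def DepthGE {R : Type*} [CommRing R] [IsLocalRing R] : ℕ → Ideal R → Prop
  | 0, _ => True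
  | n + 1, J => ∃ x ∈ maximalIdeal R, NZmod J x ∧ DepthGE n (J ⊔ Ideal.span {x})

theorem mem_sup_span {R : Type*} [CommRing R] {J : Ideal R} {x a : R} :
    a ∈ J ⊔ Ideal.span {x} ↔ ∃ c, a - x * c ∈ J := by
  rw [Submodule.mem_sup]
  constructor
  · rintro ⟨j, hj, z, hz, rfl⟩
    obtain ⟨c, rfl⟩ := Ideal.mem_span_singleton'.1 hz
    exact ⟨c, by convert hj using 1; ring⟩
  · rintro ⟨c, hc⟩
    exact ⟨_, hc, x * c, Ideal.mem_span_singleton.2 ⟨c, rfl⟩, by ring⟩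

theorem NZmod.swap {R : Type*} [CommRing R] {J : Ideal R} {x y : R} (hx : NZmod J x)
    (hy : NZmod (J ⊔ Ideal.span {x}) y) : NZmod (J ⊔ Ideal.span {y}) x := by
  intro a ha
  obtain ⟨b, hb⟩ := mem_sup_span.1 ha
  have h1 : b ∈ J ⊔ Ideal.span {x} := by
    apply hy
    rw [mem_sup_span]
    exact ⟨a, by convert J.neg_mem hb using 1; ring⟩
  obtain ⟨c, hc⟩ := mem_sup_span.1 h1
  rw [mem_sup_span]
  refine ⟨c, hx _ ?_⟩
  convert J.add_mem hb (J.mul_mem_left y hc) using 1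
  ring

theorem nakayama_ideal {R : Type*} [CommRing R] [IsLocalRing R] [IsNoetherianRing R]
    {J N : Ideal R} {x : R} (hx : x ∈ maximalIdeal R)
    (h : ∀ a ∈ N, ∃ c ∈ N, a - x * c ∈ J) : N ≤ J := by
  refine Submodule.le_of_le_smul_of_le_jacobson_bot (I := maximalIdeal R)
    (IsNoetherian.noetherian N) (IsLocalRing.maximalIdeal_le_jacobson _) ?_
  intro a ha
  obtain ⟨c, hc, h⟩ := h a ha
  rw [Submodule.mem_sup]
  exact ⟨_, h, x * c, Submodule.smul_mem_smul hx hc, by ring⟩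

theorem NZmod.of_sup {R : Type*} [CommRing R] [IsLocalRing R] [IsNoetherianRing R]
    {J : Ideal R} {x y : R} (hxm : x ∈ maximalIdeal R) (hx : NZmod J x)
    (hy : NZmod (J ⊔ Ideal.span {x}) y) : NZmod J y := by
  let N : Ideal R := Submodule.comap (LinearMap.mulLeft R y) J
  have hN : N ≤ J := by
    refine nakayama_ideal hxm ?_
    intro a ha
    have ha : y * a ∈ J := ha
    obtain ⟨c, hc⟩ := mem_sup_span.1 (hy a (Ideal.mem_sup_left ha))
    refine ⟨c, ?_, hc⟩
    change y * c ∈ J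
    apply hx
    convert J.sub_mem ha (J.mul_mem_left y hc) using 1
    ring
  exact fun a ha => hN ha

theorem socle_exchange {R : Type*} [CommRing R] [IsLocalRing R] {J : Ideal R} {x y : R}
    (hxm : x ∈ maximalIdeal R) (hx : NZmod J x) (hy : NZmod J y)
    (h : ∃ u, u ∉ J ⊔ Ideal.span {y} ∧ ∀ r ∈ maximalIdeal R, r * u ∈ J ⊔ Ideal.span {y}) :
    ∃ u, u ∉ J ⊔ Ideal.span {x} ∧ ∀ r ∈ maximalIdeal R, r * u ∈ J ⊔ Ideal.span {x} := by
  obtain ⟨u, hu, hm⟩ := h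
  obtain ⟨v, hv⟩ := mem_sup_span.1 (hm x hxm)
  refine ⟨v, ?_, ?_⟩
  · intro hv'
    obtain ⟨c, hc⟩ := mem_sup_span.1 hv'
    refine hu (mem_sup_span.2 ⟨c, hx _ ?_⟩)
    convert J.add_mem hv (J.mul_mem_left y hc) using 1
    ring
  · intro r hr
    obtain ⟨b, hb⟩ := mem_sup_span.1 (hm r hr)
    refine mem_sup_span.2 ⟨b, hy _ ?_⟩
    convert J.sub_mem (J.mul_mem_left x hb) (J.mul_mem_left r hv) using 1
    ring

theorem exists_assoc {R : Type*} [CommRing R] [IsNoetherianRing R] {J : Ideal R} {u : R}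
    (hu : u ∉ J) : ∃ P ∈ associatedPrimes R (R ⧸ J), ∀ r, r * u ∈ J → r ∈ P := by
  obtain ⟨P, hP, h⟩ := exists_le_isAssociatedPrime_of_isNoetherianRing R
    (Ideal.Quotient.mk J u) (by rwa [Ne, Ideal.Quotient.eq_zero_iff_mem])
  refine ⟨P, hP, fun r hr => h ?_⟩
  rw [Submodule.mem_colon_singleton, Submodule.mem_bot]
  exact Ideal.Quotient.eq_zero_iff_mem.2 hr

theorem assoc_elt {R : Type*} [CommRing R] [IsNoetherianRing R] {J P : Ideal R}
    (hP : P ∈ associatedPrimes R (R ⧸ J)) : P.IsPrime ∧ ∃ u, ∀ r, r ∈ P ↔ r * u ∈ J := by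
  obtain ⟨h, x, rfl⟩ := isAssociatedPrime_iff.1 hP
  refine ⟨h, ?_⟩
  obtain ⟨u, rfl⟩ := Ideal.Quotient.mk_surjective x
  refine ⟨u, fun r => ?_⟩
  rw [Submodule.mem_colon_singleton, Submodule.mem_bot]
  exact Ideal.Quotient.eq_zero_iff_mem

theorem exists_common_nz {R : Type*} [CommRing R] [IsLocalRing R] [IsNoetherianRing R]
    {J J' : Ideal R}
    (h : ¬ ∃ u, u ∉ J ∧ ∀ r ∈ maximalIdeal R, r * u ∈ J)
    (h' : ¬ ∃ u, u ∉ J' ∧ ∀ r ∈ maximalIdeal R, r * u ∈ J') :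
    ∃ z ∈ maximalIdeal R, NZmod J z ∧ NZmod J' z := by
  by_contra hcon
  push Not at hcon
  have key := (Ideal.subset_union_prime_finite (I := maximalIdeal R)
    ((associatedPrimes.finite R (R ⧸ J)).union (associatedPrimes.finite R (R ⧸ J')))
    (f := id) ⊥ ⊥ (fun i hi _ _ => hi.elim (fun h => h.1) (fun h => h.1))).1 (by
      intro z hz
      by_cases hJ : NZmod J z
      · have := hcon z hz hJ
        unfold NZmod at this
        push Not at this
        obtain ⟨a, ha, ha'⟩ := this
        obtain ⟨P, hP, h⟩ := exists_assoc ha'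
        exact Set.mem_biUnion (Or.inr hP) (h z ha)
      · unfold NZmod at hJ
        push Not at hJ
        obtain ⟨a, ha, ha'⟩ := hJ
        obtain ⟨P, hP, h⟩ := exists_assoc ha'
        exact Set.mem_biUnion (Or.inl hP) (h z ha))
  obtain ⟨P, hP, hle⟩ := key
  have aux : ∀ L : Ideal R, P ∈ associatedPrimes R (R ⧸ L) →
      ∃ u, u ∉ L ∧ ∀ r ∈ maximalIdeal R, r * u ∈ L := by
    intro L hL
    obtain ⟨hp, u, hu⟩ := assoc_elt hL
    refine ⟨u, fun hu' => hp.one_notMem ((hu 1).2 (by simpa using hu')), fun r hr => ?_⟩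
    exact (hu r).1 (hle hr)
  rcases hP with hP | hP
  · exact h (aux _ hP)
  · exact h' (aux _ hP)

theorem DepthGE.quot {R : Type*} [CommRing R] [IsLocalRing R] [IsNoetherianRing R] (n : ℕ) :
    ∀ (J : Ideal R) (y : R), DepthGE (n + 1) J → y ∈ maximalIdeal R → NZmod J y →
      DepthGE n (J ⊔ Ideal.span {y}) := by
  induction n with
  | zero => intros; trivial
  | succ n ih =>
    rintro J y ⟨x, hxm, hx, hD⟩ hym hy
    have hsx : ¬ ∃ u, u ∉ J ⊔ Ideal.span {x} ∧
        ∀ r ∈ maximalIdeal R, r * u ∈ J ⊔ Ideal.span {x} := by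
      rintro ⟨u, hu, h⟩
      obtain ⟨t, htm, ht, -⟩ := hD
      exact hu (ht _ (h t htm))
    have hsy := fun h => hsx (socle_exchange hxm hx hy h)
    obtain ⟨z, hzm, hzx, hzy⟩ := exists_common_nz hsx hsy
    have h1 : DepthGE n (J ⊔ Ideal.span {x} ⊔ Ideal.span {z}) := ih _ z hD hzm hzx
    have h2 : DepthGE (n + 1) (J ⊔ Ideal.span {z}) :=
      ⟨x, hxm, hx.swap hzx, by rwa [sup_right_comm]⟩
    have h3 := ih _ y h2 hym (hy.swap hzy)
    exact ⟨z, hzm, hzy, by rwa [sup_right_comm]⟩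

theorem dim_quot_lt {R : Type*} [CommRing R] {P Q : Ideal R} [P.IsPrime] {x : R}
    (hPQ : P ≤ Q) (hx : x ∈ Q) (hxP : x ∉ P) :
    ringKrullDim (R ⧸ Q) + 1 ≤ ringKrullDim (R ⧸ P) := by
  have hne : Ideal.Quotient.mk P x ≠ 0 := by rwa [Ne, Ideal.Quotient.eq_zero_iff_mem]
  refine le_trans ?_ (ringKrullDim_quotient_succ_le_of_nonZeroDivisor
    (mem_nonZeroDivisors_of_ne_zero hne))
  gcongr
  let φ : (R ⧸ P) ⧸ Ideal.span {Ideal.Quotient.mk P x} →+* R ⧸ Q :=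
    Ideal.Quotient.lift _ (Ideal.Quotient.factor hPQ) (by
      intro a ha
      obtain ⟨c, rfl⟩ := Ideal.mem_span_singleton'.1 ha
      rw [map_mul, Ideal.Quotient.factor_mk, Ideal.Quotient.eq_zero_iff_mem.2 hx, mul_zero])
  refine ringKrullDim_le_of_surjective φ ?_
  exact Ideal.Quotient.lift_surjective_of_surjective _ _ (Ideal.Quotient.factor_surjective hPQ)

theorem DepthGE.le_dim {R : Type*} [CommRing R] [IsLocalRing R] [IsNoetherianRing R] (n : ℕ) :
    ∀ (J P : Ideal R), DepthGE n J → P ∈ associatedPrimes R (R ⧸ J) →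
      (n : WithBot ℕ∞) ≤ ringKrullDim (R ⧸ P) := by
  induction n with
  | zero =>
    intro J P _ hP
    have := hP.1
    simpa using ringKrullDim_nonneg_of_nontrivial
  | succ n ih =>
    rintro J P ⟨x, hxm, hx, hD⟩ hP
    obtain ⟨hprime, u, hu⟩ := assoc_elt hP
    have huJ : u ∉ J := fun hu' => hprime.one_notMem ((hu 1).2 (by simpa using hu'))
    have hxP : x ∉ P := fun h => huJ (hx _ ((hu x).1 h))
    have : ∃ v, (∀ p ∈ P, p * v ∈ J) ∧ v ∉ J ⊔ Ideal.span {x} := by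
      by_contra hcon
      push Not at hcon
      let N : Ideal R :=
        { carrier := {a | ∀ p ∈ P, p * a ∈ J}
          add_mem' := fun ha hb p hp => by
            rw [mul_add]; exact J.add_mem (ha p hp) (hb p hp)
          zero_mem' := fun p _ => by simp
          smul_mem' := fun c a ha p hp => by
            rw [smul_eq_mul, mul_left_comm]; exact J.mul_mem_left _ (ha p hp) }
      have hN : N ≤ J := by
        refine nakayama_ideal hxm ?_
        intro a ha
        obtain ⟨c, hc⟩ := mem_sup_span.1 (hcon a ha)
        refine ⟨c, ?_, hc⟩
        intro p hp
        apply hx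
        convert J.sub_mem (ha p hp) (J.mul_mem_left p hc) using 1
        ring
      exact huJ (hN fun p hp => (hu p).1 hp)
    obtain ⟨v, hv, hvn⟩ := this
    obtain ⟨Q, hQ, hQv⟩ := exists_assoc hvn
    have h1 := ih _ Q hD hQ
    have h2 : ringKrullDim (R ⧸ Q) + 1 ≤ ringKrullDim (R ⧸ P) := by
      refine dim_quot_lt (x := x) (fun p hp => hQv _ (Ideal.mem_sup_left (hv p hp))) ?_ hxP
      exact hQv _ (Ideal.mem_sup_right (Ideal.mul_mem_right _ _ (Ideal.mem_span_singleton_self x)))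
    refine le_trans ?_ h2
    push_cast
    gcongr

theorem nz_of_depth {R : Type*} [CommRing R] [IsLocalRing R] [IsNoetherianRing R]
    (J : Ideal R) (l : List R) (hD : DepthGE (l.length + 1) J) (hl : ∀ z ∈ l, z ∈ maximalIdeal R) (y : R)
    (hp : ∀ p : Ideal R, p.IsPrime → J ≤ p → (∀ z ∈ l, z ∈ p) → y ∈ p → p = maximalIdeal R) :
    NZmod J y := by
  classical
  by_contra hcon
  unfold NZmod at hcon
  push Not at hcon
  obtain ⟨u, hu, huJ⟩ := hcon
  obtain ⟨P, hP, hPu⟩ := exists_assoc huJ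
  have hdim := DepthGE.le_dim _ J P hD hP
  have hprime := hP.1
  have hyP : y ∈ P := hPu y hu
  have hJP : J ≤ P := fun j hj => hPu j (J.mul_mem_right _ hj)
  have hnt : Nontrivial (R ⧸ P) := Ideal.Quotient.nontrivial_iff.2 hprime.ne_top
  have hloc : IsLocalRing (R ⧸ P) :=
    IsLocalRing.of_surjective' (Ideal.Quotient.mk P) Ideal.Quotient.mk_surjective
  let S : Finset (R ⧸ P) := (l.map (Ideal.Quotient.mk P)).toFinset
  have hcard : S.card ≤ l.length := by
    simpa using List.toFinset_card_le (l.map (Ideal.Quotient.mk P))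
  have hmin : maximalIdeal (R ⧸ P) ∈ (Ideal.span (S : Set (R ⧸ P))).minimalPrimes := by
    refine ⟨⟨inferInstance, ?_⟩, ?_⟩
    · rw [Ideal.span_le]
      intro z hz
      simp only [S, List.coe_toFinset, List.mem_map, Set.mem_ofPred_eq] at hz
      obtain ⟨z, hz, rfl⟩ := hz
      intro hunit
      have : IsLocalHom (Ideal.Quotient.mk P) :=
        isLocalHom_of_le_jacobson_bot P
          ((le_maximalIdeal hprime.ne_top).trans (maximalIdeal_le_jacobson _))
      exact hl z hz (isUnit_of_map_unit _ _ hunit)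
    · rintro q ⟨hq, hSq⟩ -
      have hc := hp (q.comap (Ideal.Quotient.mk P)) inferInstance
        (fun j hj => by
          rw [Ideal.mem_comap, Ideal.Quotient.eq_zero_iff_mem.2 (hJP hj)]; exact q.zero_mem)
        (fun z hz => hSq (Ideal.subset_span (by
          simp only [S, List.coe_toFinset, List.mem_map, Set.mem_ofPred_eq]
          exact ⟨z, hz, rfl⟩)))
        (by rw [Ideal.mem_comap, Ideal.Quotient.eq_zero_iff_mem.2 hyP]; exact q.zero_mem)
      intro t ht
      obtain ⟨t, rfl⟩ := Ideal.Quotient.mk_surjective t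
      change t ∈ q.comap (Ideal.Quotient.mk P)
      rw [hc]
      intro hunit
      exact ht (hunit.map _)
  have h1 := Ideal.height_le_card_of_mem_minimalPrimes_span_finset hmin
  rw [← IsLocalRing.maximalIdeal_height_eq_ringKrullDim] at hdim
  have h2 : ((l.length + 1 : ℕ) : ℕ∞) ≤ (maximalIdeal (R ⧸ P)).height := by
    exact_mod_cast hdim
  have h3 : ((l.length + 1 : ℕ) : ℕ∞) ≤ (l.length : ℕ∞) :=
    h2.trans (h1.trans (by exact_mod_cast hcard))
  have h4 : l.length + 1 ≤ l.length := by exact_mod_cast h3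
  omega

theorem nz_last {R : Type*} [CommRing R] [IsLocalRing R] [IsNoetherianRing R]
    (l : List R) : ∀ (J : Ideal R), DepthGE (l.length + 1) J → (∀ z ∈ l, z ∈ maximalIdeal R) →
    ∀ y ∈ maximalIdeal R,
    (∀ p : Ideal R, p.IsPrime → J ≤ p → (∀ z ∈ l, z ∈ p) → y ∈ p → p = maximalIdeal R) →
    NZmod (J ⊔ Ideal.ofList l) y := by
  induction l with
  | nil =>
    intro J hD hl y _ hp
    simpa using nz_of_depth J [] hD hl y hp
  | cons a l ih =>
    intro J hD hl y hy hp
    rw [Ideal.ofList_cons, ← sup_assoc]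
    have ha : NZmod J a := by
      refine nz_of_depth J (y :: l) hD ?_ a ?_
      · simp only [List.mem_cons, forall_eq_or_imp] at hl ⊢
        exact ⟨hy, hl.2⟩
      intro p h1 h2 h3 h4
      simp only [List.mem_cons, forall_eq_or_imp] at h3 hp
      exact hp p h1 h2 ⟨h4, h3.2⟩ h3.1
    simp only [List.mem_cons, forall_eq_or_imp] at hl hp
    refine ih _ (DepthGE.quot _ _ _ hD hl.1 ha) hl.2 y hy ?_
    intro p h1 h2 h3 h4
    rw [sup_le_iff, Ideal.span_singleton_le_iff_mem] at h2
    exact hp p h1 h2.1 ⟨h2.2, h3⟩ h4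

end LocalPart

section PolyPart

open MvPolynomial

theorem NZmod.map_loc {A : Type*} [CommRing A] (m : Ideal A) [m.IsPrime] {J : Ideal A} {x : A}
    (h : NZmod J x) : NZmod (J.map (algebraMap A (Localization.AtPrime m)))
      (algebraMap A (Localization.AtPrime m) x) := by
  intro a ha
  obtain ⟨b, u, rfl⟩ := IsLocalization.exists_mk'_eq m.primeCompl a
  rw [IsLocalization.mul_mk'_eq_mk'_of_mul, IsLocalization.mk'_mem_map_algebraMap_iff] at ha
  rw [IsLocalization.mk'_mem_map_algebraMap_iff]
  obtain ⟨v, hv, hvb⟩ := ha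
  exact ⟨v, hv, h _ (by convert hvb using 1; ring)⟩

theorem nz_X {s : ℕ} {K : Type*} [Field K] {T : Set (Fin s)} {k : Fin s} (hk : k ∉ T) :
    NZmod (Ideal.span (X '' T : Set (MvPolynomial (Fin s) K))) (X k) := by
  intro a ha
  rw [mem_ideal_span_X_image] at ha ⊢
  intro d hd
  obtain ⟨i, hi, hne⟩ := ha (Finsupp.single k 1 + d) (by
    rw [mem_support_iff] at hd ⊢
    rwa [coeff_X_mul])
  refine ⟨i, hi, ?_⟩
  have : k ≠ i := fun h => hk (h ▸ hi)
  simpa [Finsupp.single_apply, this] using hne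

theorem depth_loc {s : ℕ} {K : Type*} [Field K] (m : Ideal (MvPolynomial (Fin s) K)) [m.IsPrime]
    (hm : ∀ i, X i ∈ m) (n : ℕ) : ∀ k, k + n = s →
    DepthGE n ((Ideal.span (X '' {i : Fin s | (i : ℕ) < k} : Set (MvPolynomial (Fin s) K))).map
      (algebraMap _ (Localization.AtPrime m))) := by
  induction n with
  | zero => intros; trivial
  | succ n ih =>
    intro k hk
    let κ : Fin s := ⟨k, by omega⟩
    refine ⟨algebraMap _ _ (X κ), ?_, (nz_X (k := κ) (by simp [κ])).map_loc m, ?_⟩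
    · rw [IsLocalization.AtPrime.to_map_mem_maximal_iff _ m]
      exact hm _
    · convert ih (k + 1) (by omega) using 1
      rw [← Set.image_singleton, ← Ideal.map_span, ← Ideal.map_sup, ← Ideal.span_union,
        ← Set.image_singleton, ← Set.image_union]
      congr 3
      ext i
      simp only [Set.mem_ofPred_eq, Set.mem_union, Set.mem_singleton_iff, κ, Fin.ext_iff]
      omega

theorem mem_of_unit_mul {s : ℕ} {K : Type*} [Field K]
    (w : Fin s → ℕ) (hw : ∀ i, 0 < w i)
    (I : Ideal (MvPolynomial (Fin s) K)) (G : Set (MvPolynomial (Fin s) K))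
    (hG : ∀ g ∈ G, ∃ d : ℕ, IsWeightedHomogeneous w g d)
    (hI : I = Ideal.span G) (u f : MvPolynomial (Fin s) K) (hu : constantCoeff u ≠ 0)
    (h : u * f ∈ I) : f ∈ I := by
  let _ := weightedGradedAlgebra K w
  have hhom : I.IsHomogeneous (weightedHomogeneousSubmodule K w) := by
    rw [hI]
    refine Ideal.homogeneous_span _ _ ?_
    intro g hg
    obtain ⟨d, hd⟩ := hG g hg
    exact ⟨d, hd⟩
  let v := 1 - C (constantCoeff u)⁻¹ * u
  have hv0 : constantCoeff v = 0 := by simp [v, hu]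
  have hvf : f - v * f ∈ I := by
    convert I.mul_mem_left (C (constantCoeff u)⁻¹) h using 1
    simp only [v]; ring
  have hpow : ∀ n : ℕ, f - v ^ n * f ∈ I := by
    intro n
    induction n with
    | zero => simp
    | succ n ih =>
      convert I.add_mem hvf (I.mul_mem_left v ih) using 1
      ring
  have hwt : ∀ n : ℕ, ∀ d ∈ (v ^ n * f).support, n ≤ Finsupp.weight w d := by
    intro n
    induction n with
    | zero => simp
    | succ n ih =>
      intro d hd
      rw [pow_succ', mul_assoc] at hd
      obtain ⟨a, ha, b, hb, rfl⟩ := Finset.mem_add.1 (support_mul _ _ hd)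
      have h1 := ih b hb
      have h2 : 1 ≤ Finsupp.weight w a := by
        rw [Nat.one_le_iff_ne_zero]
        intro h0
        have ha0 : a = 0 := by
          ext i
          by_contra hi
          have := Finsupp.le_weight w (s := i) (hw i).ne' a
          simp at hi
          omega
        rw [mem_support_iff, ha0] at ha
        exact ha hv0
      rw [map_add]
      omega
  rw [mem_iff_weightedHomogeneousComponent_mem K w hhom]
  intro d
  have h1 := weightedHomogeneousComponent_mem_of_mem K w hhom (hpow (d + 1)) d
  rw [map_sub, weightedHomogeneousComponent_eq_zero' d (v ^ (d + 1) * f), sub_zero] at h1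
  · exact h1
  · intro e he h
    have := hwt _ e he
    omega

theorem prime_contains_X {s : ℕ} {K : Type*} [Field K]
    (I : Ideal (MvPolynomial (Fin s) K)) (G : Set (MvPolynomial (Fin s) K))
    (hG : ∀ g ∈ G, IsBinomial g)
    (hI : I = Ideal.span G) (i : Fin s)
    (hV : zeroSet (I ⊔ Ideal.span {X i}) = {0}) (p : Ideal (MvPolynomial (Fin s) K))
    (hp : p.IsPrime) (hIp : I ≤ p) (hi : X i ∈ p) (j : Fin s) : X j ∈ p := by
  classical
  by_contra hj
  let x : Fin s → K := fun k => if X k ∈ p then 0 else 1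
  have hmon : ∀ a : Fin s → ℕ, eval x (monomial (toFs a) (1 : K)) =
      if monomial (toFs a) (1 : K) ∈ p then 0 else 1 := by
    intro a
    have hm : monomial (toFs a) (1 : K) = ∏ k, X k ^ a k := by
      rw [monomial_eq, Finsupp.prod_fintype _ _ (by simp)]
      simp
    rw [hm]
    simp only [map_prod, map_pow, eval_X]
    split_ifs with h
    · obtain ⟨k, -, hk⟩ := hp.prod_mem_iff.1 h
      have hak : a k ≠ 0 := by
        intro h0
        rw [h0, pow_zero] at hk
        exact hp.one_notMem hk
      refine Finset.prod_eq_zero (Finset.mem_univ k) ?_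
      simp [x, hp.mem_of_pow_mem _ hk, hak]
    · refine Finset.prod_eq_one fun k _ => ?_
      by_cases hak : a k = 0
      · simp [hak]
      · have : X k ∉ p := fun hk => h (hp.prod_mem_iff.2 ⟨k, Finset.mem_univ k,
          Ideal.pow_mem_of_mem _ hk _ (Nat.pos_of_ne_zero hak)⟩)
        simp [x, this]
  have hle : I ⊔ Ideal.span {X i} ≤ RingHom.ker (eval x) := by
    refine sup_le ?_ ?_
    · rw [hI, Ideal.span_le]
      intro g hg
      have hgp : g ∈ p := hIp (hI ▸ Ideal.subset_span hg)
      obtain ⟨a, b, rfl⟩ := hG g hg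
      have hiff : monomial (toFs a) (1 : K) ∈ p ↔ monomial (toFs b) (1 : K) ∈ p :=
        ⟨fun h => by simpa using p.sub_mem h hgp, fun h => by simpa using p.add_mem hgp h⟩
      rw [SetLike.mem_coe, RingHom.mem_ker, map_sub, hmon, hmon, if_congr hiff rfl rfl, sub_self]
    · rw [Ideal.span_singleton_le_iff_mem, RingHom.mem_ker, eval_X]
      simp [x, hi]
  have hx : x ∈ zeroSet (I ⊔ Ideal.span {X i}) := fun f hf => hle hf
  rw [hV] at hx
  have := congrFun (Set.mem_singleton_iff.1 hx) j
  simp [x, hj] at this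

theorem var_nz {s : ℕ} {K : Type*} [Field K]
    (w : Fin s → ℕ) (hw : ∀ i, 0 < w i)
    (I : Ideal (MvPolynomial (Fin s) K)) (G : Set (MvPolynomial (Fin s) K))
    (hG : ∀ g ∈ G, IsBinomial g ∧ ∃ d : ℕ, IsWeightedHomogeneous w g d)
    (hI : I = Ideal.span G)
    (hV : ∀ i : Fin s, zeroSet (I ⊔ Ideal.span {X i}) = {0})
    (hci : ∃ g : Fin (s - 1) → MvPolynomial (Fin s) K, I = Ideal.span (Set.range g))
    (i : Fin s) (f : MvPolynomial (Fin s) K) (hf : X i * f ∈ I) : f ∈ I := by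
  obtain ⟨g, hg⟩ := hci
  let m : Ideal (MvPolynomial (Fin s) K) := RingHom.ker constantCoeff
  have hm : m.IsPrime := RingHom.ker_isPrime _
  have hXm : ∀ i, X i ∈ m := fun i => by simp [m, RingHom.mem_ker]
  have hIm : I ≤ m := by
    intro a ha
    have h0 : (0 : Fin s → K) ∈ zeroSet (I ⊔ Ideal.span {X i}) := by rw [hV i]; rfl
    have := h0 a (Ideal.mem_sup_left ha)
    rw [RingHom.mem_ker]
    simpa using this
  have hmX : ∀ p : Ideal (MvPolynomial (Fin s) K), (∀ j, X j ∈ p) → m ≤ p := by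
    intro p hp a ha
    have : a ∈ Ideal.span (X '' (Set.univ : Set (Fin s)) : Set (MvPolynomial (Fin s) K)) := by
      rw [mem_ideal_span_X_image]
      intro d hd
      by_contra hcon
      push Not at hcon
      have hd0 : d = 0 := by ext j; exact hcon j trivial
      rw [mem_support_iff, hd0] at hd
      exact hd ha
    refine (Ideal.span_le.2 ?_) this
    rintro _ ⟨j, -, rfl⟩
    exact hp j
  let R := Localization.AtPrime m
  have : IsNoetherianRing R := IsLocalization.isNoetherianRing m.primeCompl R inferInstance
  let φ := algebraMap (MvPolynomial (Fin s) K) R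
  let l : List R := List.ofFn (fun j => φ (g j))
  have hs : 0 < s := i.pos
  have hlen : l.length + 1 = s := by simp [l]; omega
  have hofl : Ideal.ofList l = I.map φ := by
    rw [hg, Ideal.map_span]
    unfold Ideal.ofList
    congr 1
    ext z
    simp [l, List.mem_ofFn]
  have hD : DepthGE (l.length + 1) (⊥ : Ideal R) := by
    have := depth_loc m hXm s 0 (by simp)
    rw [hlen]
    simpa using this
  have hgI : ∀ j, g j ∈ I := fun j => by rw [hg]; exact Ideal.subset_span ⟨j, rfl⟩
  have key : NZmod (⊥ ⊔ Ideal.ofList l) (φ (X i)) := by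
    refine nz_last l ⊥ hD ?_ _ ?_ ?_
    · intro z hz
      obtain ⟨j, rfl⟩ := (List.mem_ofFn' _ _).1 hz
      exact (IsLocalization.AtPrime.to_map_mem_maximal_iff R m _).2 (hIm (hgI j))
    · exact (IsLocalization.AtPrime.to_map_mem_maximal_iff R m _).2 (hXm i)
    · intro p hp _ hlp hyp
      have hIp : I ≤ p.comap φ := by
        rw [hg, Ideal.span_le]
        rintro _ ⟨j, rfl⟩
        exact hlp _ ((List.mem_ofFn' _ _).2 ⟨j, rfl⟩)
      have h1 := hmX (p.comap φ) (prime_contains_X I G (fun g hg => (hG g hg).1) hI i (hV i)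
        (p.comap φ) inferInstance hIp hyp)
      refine le_antisymm (IsLocalRing.le_maximalIdeal hp.ne_top) ?_
      rw [← Localization.AtPrime.map_eq_maximalIdeal, Ideal.map_le_iff_le_comap]
      exact h1
  rw [bot_sup_eq, hofl] at key
  have h2 := key (φ f) (by rw [← map_mul]; exact Ideal.mem_map_of_mem φ hf)
  obtain ⟨u, hu, huf⟩ := (IsLocalization.algebraMap_mem_map_algebraMap_iff m.primeCompl R I f).1 h2
  exact mem_of_unit_mul w hw I G (fun g hg => (hG g hg).2) hI u f hu huf

theorem monomial_cancel {s : ℕ} {K : Type*} [Field K] (I : Ideal (MvPolynomial (Fin s) K))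
    (h : ∀ (i : Fin s) (f : MvPolynomial (Fin s) K), X i * f ∈ I → f ∈ I)
    (c : Fin s →₀ ℕ) : ∀ f : MvPolynomial (Fin s) K, monomial c (1 : K) * f ∈ I → f ∈ I := by
  induction c using Finsupp.induction_linear with
  | zero => intro f hf; simpa using hf
  | add a b ha hb =>
    intro f hf
    apply hb
    apply ha
    rwa [← mul_assoc, monomial_mul, one_mul]
  | single i n =>
    intro f hf
    rw [← X_pow_eq_monomial] at hf
    induction n with
    | zero => simpa using hf
    | succ n ih =>
      apply ih
      apply h i
      rwa [← mul_assoc, ← pow_succ']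

theorem lattice_of_nz {s : ℕ} {K : Type*} [Field K]
    (I : Ideal (MvPolynomial (Fin s) K)) (G : Set (MvPolynomial (Fin s) K))
    (hG : ∀ g ∈ G, IsBinomial g) (hI : I = Ideal.span G)
    (h : ∀ (i : Fin s) (f : MvPolynomial (Fin s) K), X i * f ∈ I → f ∈ I) :
    ∃ 𝓛 : AddSubgroup (Fin s → ℤ), I = latticeIdeal K 𝓛 := by
  have red : ∀ a b a' b' : Fin s → ℕ, (∀ i, (a i : ℤ) - b i = a' i - b' i) →
      (∀ i, a i ≤ a' i) →
      monomial (toFs a') (1 : K) - monomial (toFs b') 1 =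
      monomial (toFs fun i => a' i - a i) (1 : K) *
        (monomial (toFs a) (1 : K) - monomial (toFs b) 1) := by
    intro a b a' b' h1 h2
    rw [mul_sub, monomial_mul, monomial_mul, one_mul]
    congr 2
    · congr 1
      ext i
      have := h2 i
      simp; omega
    · congr 1
      ext i
      have := h2 i
      have := h1 i
      simp; omega
  have hcancel : ∀ a b a' b' : Fin s → ℕ, (∀ i, (a i : ℤ) - b i = a' i - b' i) →
      (∀ i, a i ≤ a' i) → monomial (toFs a') (1 : K) - monomial (toFs b') 1 ∈ I →
      monomial (toFs a) (1 : K) - monomial (toFs b) 1 ∈ I := by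
    intro a b a' b' h1 h2 h3
    rw [red a b a' b' h1 h2] at h3
    exact monomial_cancel I h _ _ h3
  let 𝓛 : AddSubgroup (Fin s → ℤ) :=
    { carrier := {a | monomial (toFs fun i => (a i).toNat) (1 : K) -
        monomial (toFs fun i => (-a i).toNat) 1 ∈ I}
      zero_mem' := by simp
      neg_mem' := by
        intro a ha
        rw [Set.mem_ofPred_eq] at ha ⊢
        rw [← neg_sub]
        simpa using I.neg_mem ha
      add_mem' := by
        intro a b ha hb
        rw [Set.mem_ofPred_eq] at ha hb ⊢
        refine hcancel _ _ (fun i => (a i).toNat + (b i).toNat)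
          (fun i => (-a i).toNat + (-b i).toNat) (fun i => ?_) (fun i => ?_) ?_
        · simp only [Pi.add_apply]; omega
        · simp only [Pi.add_apply]; omega
        · have e : ∀ c d : Fin s → ℕ, monomial (toFs fun i => c i + d i) (1 : K) =
              monomial (toFs c) 1 * monomial (toFs d) 1 := by
            intro c d
            rw [monomial_mul, one_mul]
            have : (toFs fun i => c i + d i) = toFs c + toFs d := by
              ext i
              simp
            rw [this]
          rw [e, e]
          convert I.add_mem (I.mul_mem_left (monomial (toFs fun i => (b i).toNat) (1 : K)) ha)
            (I.mul_mem_left (monomial (toFs fun i => (-a i).toNat) (1 : K)) hb) using 1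
          ring }
  refine ⟨𝓛, le_antisymm ?_ ?_⟩
  · conv_lhs => rw [hI]
    rw [Ideal.span_le]
    intro g hg
    have hgI : g ∈ I := hI ▸ Ideal.subset_span hg
    obtain ⟨a, b, rfl⟩ := hG g hg
    have h1 : ∀ i, (((((a i : ℤ) - b i).toNat) : ℕ) : ℤ) - ((-((a i : ℤ) - b i)).toNat : ℕ)
        = a i - b i := fun i => by omega
    have h2 : ∀ i, ((a i : ℤ) - b i).toNat ≤ a i := fun i => by omega
    rw [SetLike.mem_coe, red _ _ a b h1 h2]
    refine Ideal.mul_mem_left _ _ (Ideal.subset_span ⟨fun i => (a i : ℤ) - b i, ?_, rfl⟩)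
    exact hcancel _ _ a b h1 h2 hgI
  · unfold latticeIdeal
    rw [Ideal.span_le]
    rintro _ ⟨a, ha, rfl⟩
    exact ha

end PolyPart

theorem graded_binomial_ci_is_lattice_ideal {s : ℕ} {K : Type*} [Field K]
    (w : Fin s → ℕ) (hw : ∀ i, 0 < w i)
    (I : Ideal (MvPolynomial (Fin s) K)) (G : Set (MvPolynomial (Fin s) K))
    (hG : ∀ g ∈ G, IsBinomial g ∧ ∃ d : ℕ, IsWeightedHomogeneous w g d)
    (hI : I = Ideal.span G)
    (hV : ∀ i : Fin s, zeroSet (I ⊔ Ideal.span {X i}) = {0})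
    (hci : ∃ g : Fin (s - 1) → MvPolynomial (Fin s) K, I = Ideal.span (Set.range g)) :
    (∃ 𝓛 : AddSubgroup (Fin s → ℤ), I = latticeIdeal K 𝓛) ∧
      ∀ (i : Fin s) (f : MvPolynomial (Fin s) K), X i * f ∈ I → f ∈ I := by
  have hnz := var_nz w hw I G hG hI hV hci
  exact ⟨lattice_of_nz I G (fun g hg => (hG g hg).1) hI hnz, hnz⟩
end
end

section
/- Let 𝓛 ⊂ ℤ^s be a homogeneous lattice (with respect to a positive weight vector ω) whose lattice ideal L = I(𝓛) satisfies V(L, t_i) = {0} for all i. Then L is a complete intersection if and only if there exist homogeneous binomials h_1,...,h_{s-1} in L such that: (i) 𝓛 is generated as a group by ĥ_1,...,ĥ_{s-1}; and (ii) V(h_1,...,h_{s-1}, t_i) = {0} for all i = 1,...,s. -/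
open MvPolynomial

noncomputable section

/-! ## Hand-made Koszul complexes -/

/-- A chain complex of modules indexed by `ℤ`. -/
structure KCx (R : Type*) [CommRing R] where
  X : ℤ → Type*
  [ag : ∀ n, AddCommGroup (X n)]
  [md : ∀ n, Module R (X n)]
  d : ∀ n, X n →ₗ[R] X (n - 1)
  dd : ∀ n x, d (n - 1) (d n x) = 0

attribute [instance] KCx.ag KCx.md

namespace KCx

universe u v
variable {R : Type u} [CommRing R]

/-- The cone of multiplication by `f`. -/
def cone (f : R) (C : KCx.{u, v} R) : KCx.{u, v} R where
  X n := C.X n × C.X (n - 1)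
  d n :=
    { toFun := fun p => (C.d n p.1 + f • p.2, - C.d (n - 1) p.2)
      map_add' := by
        intro p q
        ext
        · simp only [Prod.fst_add, Prod.snd_add, map_add, smul_add]; abel
        · simp only [Prod.snd_add, map_add]; abel
      map_smul' := by
        intro r p
        ext
        · simp only [Prod.smul_fst, Prod.smul_snd, map_smul, smul_add, RingHom.id_apply,
            smul_comm f r]
        · simp }
  dd n x := by
    ext
    · simp [C.dd]
    · simp [C.dd]

theorem cone_d (f : R) (C : KCx.{u, v} R) (n : ℤ) (a : C.X n) (b : C.X (n - 1)) :
    (cone f C).d n ((a, b) : C.X n × C.X (n - 1)) =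
      ((C.d n a + f • b, - C.d (n - 1) b) : C.X (n - 1) × C.X (n - 1 - 1)) := rfl

/-- Exactness at degree `m - 1`. -/
def Ex (C : KCx.{u, v} R) (m : ℤ) : Prop :=
  ∀ x : C.X (m - 1), C.d (m - 1) x = 0 → ∃ y : C.X m, C.d m y = x

/-- `f` is injective on the homology in degree `m - 1`. -/
def Inj (f : R) (C : KCx.{u, v} R) (m : ℤ) : Prop :=
  ∀ x : C.X (m - 1), C.d (m - 1) x = 0 → (∃ y : C.X m, C.d m y = f • x) →
    ∃ y : C.X m, C.d m y = x

theorem Ex.inj {C : KCx.{u, v} R} {m : ℤ} (h : C.Ex m) (f : R) : Inj f C m :=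
  fun x hx _ => h x hx

theorem ex_cone {f : R} {C : KCx.{u, v} R} {m : ℤ} (h : C.Ex m) (hi : Inj f C (m - 1)) :
    (cone f C).Ex m := by
  rintro ⟨a, b⟩ hx
  have h1 : C.d (m - 1) a + f • b = 0 := congrArg Prod.fst hx
  have h2 : - C.d (m - 1 - 1) b = 0 := congrArg Prod.snd hx
  have h2' : C.d (m - 1 - 1) b = 0 := by simpa using h2
  obtain ⟨b', hb'⟩ := hi b h2' ⟨-a, by
    rw [map_neg]; exact (eq_neg_of_add_eq_zero_right h1).symm⟩
  obtain ⟨a', ha'⟩ := h (a + f • b') (by rw [map_add, map_smul, hb', h1])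
  refine ⟨((a', -b') : C.X m × C.X (m - 1)), ?_⟩
  rw [cone_d, ha', map_neg, hb']
  refine Prod.ext ?_ ?_
  · change a + f • b' + f • -b' = a
    simp
  · exact neg_neg b

theorem inj_of_ex_cone {f : R} {C : KCx.{u, v} R} {m : ℤ} (h : (cone f C).Ex m) :
    Inj f C (m - 1) := by
  rintro b hb ⟨a, ha⟩
  obtain ⟨⟨a'', b''⟩, hy⟩ := h ((-a, b) : C.X (m - 1) × C.X (m - 1 - 1)) (by
    rw [cone_d, map_neg, ha, hb]
    exact Prod.ext (neg_add_cancel _) neg_zero)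
  rw [cone_d] at hy
  refine ⟨-b'', ?_⟩
  rw [map_neg]
  exact congrArg Prod.snd hy

/-- The ideal of elements which kill all the homology. -/
def Ann (C : KCx.{u, v} R) : Ideal R where
  carrier := {g | ∀ m, ∀ x : C.X (m - 1), C.d (m - 1) x = 0 → ∃ y : C.X m, C.d m y = g • x}
  zero_mem' := fun m x _ => ⟨0, by simp⟩
  add_mem' := by
    intro g g' hg hg' m x hx
    obtain ⟨y, hy⟩ := hg m x hx
    obtain ⟨y', hy'⟩ := hg' m x hx
    exact ⟨y + y', by rw [map_add, hy, hy', add_smul]⟩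
  smul_mem' := by
    intro r g hg m x hx
    obtain ⟨y, hy⟩ := hg m x hx
    exact ⟨r • y, by rw [map_smul, hy, smul_smul, smul_eq_mul]⟩

theorem mem_ann_cone (f : R) (C : KCx.{u, v} R) : f ∈ (cone f C).Ann := by
  rintro m ⟨a, b⟩ hx
  have h1 : C.d (m - 1) a + f • b = 0 := congrArg Prod.fst hx
  have h2 : - C.d (m - 1 - 1) b = 0 := congrArg Prod.snd hx
  refine ⟨((0, a) : C.X m × C.X (m - 1)), ?_⟩
  rw [cone_d]
  refine Prod.ext ?_ ?_
  · change C.d m 0 + f • a = f • a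
    simp
  · exact (eq_neg_of_add_eq_zero_right h1).symm

theorem sq_mem_ann_cone (f : R) {g : R} {C : KCx.{u, v} R} (hg : g ∈ C.Ann) :
    g * g ∈ (cone f C).Ann := by
  rintro m ⟨a, b⟩ hx
  have h1 : C.d (m - 1) a + f • b = 0 := congrArg Prod.fst hx
  have h2 : - C.d (m - 1 - 1) b = 0 := congrArg Prod.snd hx
  have h2' : C.d (m - 1 - 1) b = 0 := by simpa using h2
  obtain ⟨b', hb'⟩ := hg _ b h2'
  obtain ⟨a', ha'⟩ := hg _ (g • a + f • b') (by
    rw [map_add, map_smul, map_smul, hb', smul_comm f g, ← smul_add, h1, smul_zero])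
  refine ⟨((a', -(g • b')) : C.X m × C.X (m - 1)), ?_⟩
  rw [cone_d, ha', map_neg, map_smul, hb']
  refine Prod.ext ?_ ?_
  · change g • (g • a + f • b') + f • -(g • b') = (g * g) • a
    rw [smul_add, smul_neg, smul_comm f g, add_neg_cancel_right, smul_smul]
  · change - -(g • g • b) = (g * g) • b
    rw [neg_neg, smul_smul]

theorem radical_le (f : R) (C : KCx.{u, v} R) : C.Ann.radical ≤ (cone f C).Ann.radical := by
  rintro g ⟨n, hn⟩
  exact ⟨n + n, by rw [pow_add]; exact sq_mem_ann_cone f hn⟩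

theorem ex_of_ex_cone {f : R} {C : KCx.{u, v} R} {m : ℤ} (h : (cone f C).Ex m)
    (hf : f ∈ C.Ann.radical) : C.Ex (m - 1) := by
  have hi := inj_of_ex_cone h
  obtain ⟨N, hN⟩ := hf
  intro x hx
  have key : ∀ k, (∃ y, C.d (m - 1) y = f ^ k • x) → ∃ y, C.d (m - 1) y = x := by
    intro k
    induction k with
    | zero => simp
    | succ k ih =>
      rintro ⟨y, hy⟩
      exact ih (hi (f ^ k • x) (by rw [map_smul, hx, smul_zero])
        ⟨y, by rw [hy, pow_succ', mul_smul]⟩)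
  exact key N (hN _ x hx)

/-- Isomorphism of complexes. -/
structure Iso (C D : KCx.{u, v} R) where
  e : ∀ n, C.X n ≃ₗ[R] D.X n
  comm : ∀ n x, e (n - 1) (C.d n x) = D.d n (e n x)

theorem Iso.ex {C D : KCx.{u, v} R} (φ : Iso C D) {m : ℤ} (h : C.Ex m) : D.Ex m := by
  intro x hx
  obtain ⟨y, hy⟩ := h ((φ.e _).symm x) (by
    apply (φ.e _).injective
    rw [φ.comm, LinearEquiv.apply_symm_apply, hx, map_zero])
  exact ⟨φ.e _ y, by rw [← φ.comm, hy, LinearEquiv.apply_symm_apply]⟩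

def Iso.cone (f : R) {C D : KCx.{u, v} R} (φ : Iso C D) : Iso (cone f C) (cone f D) where
  e n := (φ.e n).prodCongr (φ.e (n - 1))
  comm := by
    rintro n ⟨a, b⟩
    change ((φ.e _) (C.d n a + f • b), (φ.e _) (- C.d (n - 1) b)) =
      (D.d n (φ.e _ a) + f • φ.e _ b, - D.d (n - 1) (φ.e _ b))
    rw [map_add, map_neg, map_smul, φ.comm, φ.comm]

def Iso.refl (C : KCx.{u, v} R) : Iso C C where
  e _ := LinearEquiv.refl R _
  comm _ _ := rfl

def Iso.trans {C D E : KCx.{u, v} R} (φ : Iso C D) (ψ : Iso D E) : Iso C E where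
  e n := (φ.e n).trans (ψ.e n)
  comm n x := by simp [φ.comm, ψ.comm]

def Iso.swap (f g : R) (C : KCx.{u, v} R) :
    Iso (KCx.cone g (KCx.cone f C)) (KCx.cone f (KCx.cone g C)) where
  e n :=
    { toFun := fun p => ((p.1.1, p.2.1), (p.1.2, -p.2.2))
      invFun := fun p => ((p.1.1, p.2.1), (p.1.2, -p.2.2))
      left_inv := by rintro ⟨⟨a, b⟩, ⟨c, e⟩⟩; simp only [neg_neg]; rfl
      right_inv := by rintro ⟨⟨a, b⟩, ⟨c, e⟩⟩; simp only [neg_neg]; rfl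
      map_add' := by
        rintro ⟨⟨a, b⟩, ⟨c, e⟩⟩ ⟨⟨a', b'⟩, ⟨c', e'⟩⟩
        change ((a + a', c + c'), (b + b', -(e + e'))) =
          ((a + a', c + c'), (b + b', -e + -e'))
        rw [neg_add]
      map_smul' := by
        rintro r ⟨⟨a, b⟩, ⟨c, e⟩⟩
        change ((r • a, r • c), (r • b, -(r • e))) = ((r • a, r • c), (r • b, r • (-e)))
        rw [smul_neg] }
  comm := by
    rintro n ⟨⟨a, b⟩, ⟨c, e⟩⟩
    change (((C.d n a + f • b) + g • c, -(C.d (n - 1) c + f • e)),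
        ((- C.d (n - 1) b + g • e), - (- (- C.d (n - 1 - 1) e)))) =
      (((C.d n a + g • c) + f • b, - C.d (n - 1) c + f • (-e)),
        (-(C.d (n - 1) b + g • (-e)), - (- C.d (n - 1 - 1) (-e))))
    rw [map_neg, smul_neg, smul_neg, neg_add, neg_add, neg_neg, neg_neg, add_right_comm]

/-- Iterated cones. -/
def kos : List R → KCx.{u, v} R → KCx.{u, v} R
  | [], C => C
  | f :: l, C => cone f (kos l C)

theorem kos_append (l l' : List R) (C : KCx.{u, v} R) : kos (l ++ l') C = kos l (kos l' C) := by
  induction l with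
  | nil => rfl
  | cons f l ih => rw [List.cons_append, kos, kos, ih]

theorem kos_perm {l l' : List R} (h : l.Perm l') (C : KCx.{u, v} R) :
    Nonempty (Iso (kos l C) (kos l' C)) := by
  induction h with
  | nil => exact ⟨Iso.refl _⟩
  | cons x _ ih => obtain ⟨φ⟩ := ih; exact ⟨φ.cone x⟩
  | swap x y l => exact ⟨Iso.swap _ _ _⟩
  | trans _ _ ih ih' => obtain ⟨φ⟩ := ih; obtain ⟨ψ⟩ := ih'; exact ⟨φ.trans ψ⟩

theorem ex_kos (l : List R) {C : KCx.{u, v} R} {q : ℤ} (h : ∀ m, q < m → C.Ex m) :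
    ∀ m, q + l.length < m → (kos l C).Ex m := by
  induction l with
  | nil => simpa [kos] using h
  | cons f l ih =>
    intro m hm
    simp only [List.length_cons] at hm
    push_cast at hm
    exact ex_cone (ih m (by omega)) ((ih (m - 1) (by omega)).inj f)

theorem ex_of_ex_kos (l : List R) {C : KCx.{u, v} R} {q : ℤ} (hl : ∀ f ∈ l, f ∈ C.Ann.radical)
    (h : ∀ m, q + l.length < m → (kos l C).Ex m) : ∀ m, q < m → C.Ex m := by
  have rad : ∀ l : List R, C.Ann.radical ≤ (kos l C).Ann.radical := by
    intro l
    induction l with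
    | nil => exact le_rfl
    | cons f l ih => exact ih.trans (radical_le f _)
  induction l with
  | nil => simpa [kos] using h
  | cons f l ih =>
    refine ih (fun g hg => hl g (List.mem_cons_of_mem _ hg)) fun m hm => ?_
    have := ex_of_ex_cone (h (m + 1) (by simp only [List.length_cons]; push_cast; omega))
      (rad l (hl f List.mem_cons_self))
    simpa using this

theorem mem_ann_kos (l : List R) (C : KCx.{u, v} R) : ∀ f ∈ l, f ∈ (kos l C).Ann.radical := by
  induction l with
  | nil => simp
  | cons g l ih =>
    intro f hf
    rcases List.mem_cons.1 hf with rfl | hf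
    · exact Ideal.le_radical (mem_ann_cone _ _)
    · exact radical_le _ _ (ih f hf)

/-- Homology in degree zero is `R ⧸ I`. -/
def Aug (C : KCx.{u, v} R) (I : Ideal R) : Prop :=
  (∀ n < 0, Subsingleton (C.X n)) ∧ ∃ π : C.X (1 - 1) →ₗ[R] R, Function.Bijective π ∧
    ∀ x, (∃ y, C.d 1 y = x) ↔ π x ∈ I

theorem Aug.inj_iff {C : KCx.{u, v} R} {I : Ideal R} (h : C.Aug I) (f : R) :
    Inj f C 1 ↔ ∀ g, f * g ∈ I → g ∈ I := by
  obtain ⟨h0, π, hπ, hI⟩ := h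
  have := h0 (1 - 1 - 1) (by norm_num)
  constructor
  · intro hi g hg
    obtain ⟨x, rfl⟩ := hπ.2 g
    rw [← hI]
    refine hi x (Subsingleton.elim _ _) ?_
    rw [hI, map_smul]
    exact hg
  · intro hi x _ hx
    rw [hI] at hx ⊢
    rw [map_smul] at hx
    exact hi _ hx

theorem Aug.cone {C : KCx.{u, v} R} {I : Ideal R} (h : C.Aug I) (f : R) :
    (KCx.cone f C).Aug (Ideal.span {f} ⊔ I) := by
  obtain ⟨h0, π, hπ, hI⟩ := h
  have h01 := h0 (1 - 1 - 1) (by norm_num)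
  refine ⟨fun n hn => ?_, π.comp (LinearMap.fst R (C.X (1 - 1)) (C.X (1 - 1 - 1))), ⟨?_, ?_⟩, ?_⟩
  · have := h0 n hn
    have := h0 (n - 1) (by omega)
    exact inferInstanceAs (Subsingleton (C.X n × C.X (n - 1)))
  · rintro ⟨a, b⟩ ⟨a', b'⟩ hab
    exact Prod.ext (hπ.1 hab) (Subsingleton.elim _ _)
  · intro r
    obtain ⟨x, rfl⟩ := hπ.2 r
    exact ⟨(x, 0), rfl⟩
  · rintro ⟨a, b⟩
    change _ ↔ π a ∈ _
    rw [Ideal.mem_span_singleton_sup]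
    constructor
    · rintro ⟨⟨y, z⟩, hy⟩
      rw [cone_d] at hy
      have h1 : C.d 1 y + f • z = a := congrArg Prod.fst hy
      refine ⟨π z, π (C.d 1 y), (hI _).1 ⟨y, rfl⟩, ?_⟩
      rw [← h1, map_add, map_smul, smul_eq_mul, mul_comm, add_comm]
    · rintro ⟨r, i, hi, hr⟩
      obtain ⟨z, rfl⟩ := hπ.2 r
      obtain ⟨x, rfl⟩ := hπ.2 i
      obtain ⟨y, rfl⟩ := (hI x).2 hi
      refine ⟨((y, z) : C.X 1 × C.X (1 - 1)), ?_⟩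
      rw [cone_d]
      refine Prod.ext (hπ.1 ?_) (Subsingleton.elim _ _)
      change π (C.d 1 y + f • z) = π a
      rw [← hr, map_add, map_smul, smul_eq_mul, mul_comm, add_comm]

/-- `R` in degree zero. -/
def base (R : Type u) [CommRing R] : KCx.{u, u} R where
  X n := ↥(⨆ _ : n = 0, ⊤ : Submodule R R)
  d n := 0
  dd := by simp

theorem base_sub {n : ℤ} (hn : n ≠ 0) : Subsingleton ((base R).X n) := by
  change Subsingleton ↥(⨆ _ : n = 0, ⊤ : Submodule R R)
  simp only [hn, iSup_false]
  infer_instance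

theorem base_ex {m : ℤ} (hm : 1 < m) : (base R).Ex m := by
  intro x _
  have := base_sub (R := R) (n := m - 1) (by omega)
  exact ⟨0, Subsingleton.elim _ _⟩

theorem base_aug : (base R).Aug ⊥ := by
  refine ⟨fun n hn => base_sub hn.ne, Submodule.subtype _, ⟨Subtype.val_injective, ?_⟩, ?_⟩
  · intro r
    exact ⟨⟨r, by simp⟩, rfl⟩
  · intro x
    constructor
    · rintro ⟨y, rfl⟩
      exact Submodule.zero_mem _
    · intro h
      exact ⟨0, Subtype.ext (Eq.symm h)⟩

theorem kos_aug (l : List R) : (kos l (base R)).Aug (Ideal.span {x | x ∈ l}) := by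
  induction l with
  | nil => simpa [kos] using base_aug (R := R)
  | cons f l ih =>
    have : {x | x ∈ f :: l} = {f} ∪ {x | x ∈ l} := by ext; simp
    rw [this, Ideal.span_union]
    exact ih.cone f

/-- A regular sequence (listed backwards). -/
def Reg : List R → Prop
  | [] => True
  | f :: l => Reg l ∧ ∀ g, f * g ∈ Ideal.span {x | x ∈ l} → g ∈ Ideal.span {x | x ∈ l}

theorem Reg.ex {l : List R} (h : Reg l) : ∀ m, 1 < m → (kos l (base R)).Ex m := by
  induction l with
  | nil => exact fun m hm => base_ex hm
  | cons f l ih =>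
    intro m hm
    refine ex_cone (ih h.1 m hm) ?_
    by_cases h1 : 1 < m - 1
    · exact (ih h.1 _ h1).inj f
    · obtain rfl : m = 1 + 1 := by omega
      have := ((kos_aug l).inj_iff f).2 h.2
      simpa using this

/-- If `ts` is a regular sequence, contained in the radical of the ideal of a list `f :: l`
of the same length, then `f` is regular modulo `l`. -/
theorem regular_of_radical {ts l : List R} (f : R) (hts : Reg ts)
    (hlen : ts.length = (f :: l).length)
    (hrad : ∀ t ∈ ts, t ∈ (Ideal.span {x | x ∈ f :: l}).radical) :
    ∀ g, f * g ∈ Ideal.span {x | x ∈ l} → g ∈ Ideal.span {x | x ∈ l} := by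
  have h1 := ex_kos (f :: l) hts.ex
  have h2 : ∀ m, (1 : ℤ) + ts.length < m → (kos ts (kos (f :: l) (base R))).Ex m := by
    intro m hm
    rw [← kos_append]
    obtain ⟨φ⟩ := kos_perm (List.perm_append_comm (l₁ := f :: l) (l₂ := ts)) (base R)
    refine φ.ex ?_
    rw [kos_append]
    exact h1 m (by rw [← hlen]; exact hm)
  have h3 := ex_of_ex_kos ts (fun t ht => by
    have hle : Ideal.span {x | x ∈ f :: l} ≤ (kos (f :: l) (base R)).Ann.radical :=
      Ideal.span_le.2 fun x hx => mem_ann_kos _ _ x hx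
    have := Ideal.radical_mono hle (hrad t ht)
    rwa [Ideal.radical_idem] at this) h2
  have h4 := inj_of_ex_cone (h3 (1 + 1) (by norm_num))
  rw [← (kos_aug l).inj_iff]
  simpa using h4

end KCx

/-! ## Binomials and lattices -/

section Lattice

variable {s : ℕ} {K : Type*} [Field K]

/-- The binomial `t^a - t^b`. -/
abbrev bin (K : Type*) [Field K] {s : ℕ} (a b : Fin s → ℕ) : MvPolynomial (Fin s) K :=
  monomial (toFs a) (1 : K) - monomial (toFs b) 1

/-- The class of an exponent vector in `ℤ^s / M`. -/
def clsHom (M : AddSubgroup (Fin s → ℤ)) : (Fin s →₀ ℕ) →+ (Fin s → ℤ) ⧸ M :=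
  (QuotientAddGroup.mk' M).comp
    { toFun := fun u i => (u i : ℤ)
      map_zero' := by ext; simp
      map_add' := by intros; ext; simp }

theorem mem_of_bin_mem (M : AddSubgroup (Fin s → ℤ)) (B : Set (MvPolynomial (Fin s) K))
    (hB : ∀ f ∈ B, ∃ a b : Fin s → ℕ, f = bin K a b ∧ intVec a - intVec b ∈ M)
    (u v : Fin s → ℕ) (h : bin K u v ∈ Ideal.span B) : intVec u - intVec v ∈ M := by
  let φ : MvPolynomial (Fin s) K →+* AddMonoidAlgebra K ((Fin s → ℤ) ⧸ M) :=
    AddMonoidAlgebra.mapDomainRingHom K (clsHom M)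
  have hφ : ∀ a : Fin s → ℕ, φ (monomial (toFs a) 1) =
      AddMonoidAlgebra.single (QuotientAddGroup.mk (s := M) (intVec a)) 1 := by
    intro a
    exact AddMonoidAlgebra.mapDomain_single
  have hle : Ideal.span B ≤ RingHom.ker φ := by
    rw [Ideal.span_le]
    intro f hf
    obtain ⟨a, b, rfl, hab⟩ := hB f hf
    rw [SetLike.mem_coe, RingHom.mem_ker, map_sub, hφ, hφ, sub_eq_zero]
    congr 1
    rw [eq_comm, QuotientAddGroup.eq]
    rwa [neg_add_eq_sub]
  have h0 := hle h
  rw [RingHom.mem_ker, map_sub, hφ, hφ, sub_eq_zero] at h0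
  have h1 := AddMonoidAlgebra.single_left_injective (one_ne_zero) h0
  rw [eq_comm, QuotientAddGroup.eq, neg_add_eq_sub] at h1
  exact h1

theorem intVec_pos_sub_neg (a : Fin s → ℤ) :
    intVec (fun i => (a i).toNat) - intVec (fun i => (-a i).toNat) = a := by
  ext i
  simp only [intVec, Pi.sub_apply]
  omega

theorem mem_of_bin_mem_latticeIdeal (M : AddSubgroup (Fin s → ℤ))
    (u v : Fin s → ℕ) (h : bin K u v ∈ latticeIdeal K M) : intVec u - intVec v ∈ M := by
  refine mem_of_bin_mem M _ ?_ u v h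
  rintro f ⟨a, ha, rfl⟩
  exact ⟨_, _, rfl, by rwa [intVec_pos_sub_neg]⟩

theorem mono_mul (a b : Fin s → ℕ) : (monomial (toFs a) (1 : K)) * monomial (toFs b) 1 =
    monomial (toFs (a + b)) 1 := by
  rw [monomial_mul, one_mul]
  have : toFs a + toFs b = toFs (a + b) := by ext; simp
  rw [this]

/-- Every lattice vector is realised by some binomial of the ideal. -/
theorem exists_bin_mem {ι : Type*} (a b : ι → Fin s → ℕ) (c : Fin s → ℤ)
    (hc : c ∈ AddSubgroup.closure (Set.range fun j => intVec (a j) - intVec (b j))) :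
    ∃ u v : Fin s → ℕ, intVec u - intVec v = c ∧
      bin K u v ∈ Ideal.span (Set.range fun j => bin K (a j) (b j)) := by
  induction hc using AddSubgroup.closure_induction with
  | mem x hx =>
    obtain ⟨j, rfl⟩ := hx
    exact ⟨a j, b j, rfl, Ideal.subset_span ⟨j, rfl⟩⟩
  | zero => exact ⟨0, 0, by simp, by simp⟩
  | neg x _ ih =>
    obtain ⟨u, v, rfl, h⟩ := ih
    exact ⟨v, u, by simp, by rw [bin, ← neg_sub]; exact neg_mem h⟩
  | add x y _ _ ih ih' =>
    obtain ⟨u, v, rfl, h⟩ := ih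
    obtain ⟨u', v', rfl, h'⟩ := ih'
    refine ⟨u + u', v + v', ?_, ?_⟩
    · ext i; simp [intVec]; ring
    · have : bin K (u + u') (v + v') = monomial (toFs u') 1 * bin K u v +
          monomial (toFs v) 1 * bin K u' v' := by
        rw [bin, ← mono_mul, ← mono_mul]; ring
      rw [this]
      exact add_mem (Ideal.mul_mem_left _ _ h) (Ideal.mul_mem_left _ _ h')

theorem cancel_mono (H : Ideal (MvPolynomial (Fin s) K))
    (hreg : ∀ i g, X i * g ∈ H → g ∈ H) (c : Fin s →₀ ℕ) (g : MvPolynomial (Fin s) K)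
    (h : monomial c (1 : K) * g ∈ H) : g ∈ H := by
  classical
  induction c using Finsupp.induction_linear generalizing g with
  | zero => simpa using h
  | add f f' ih ih' =>
    refine ih' g (ih _ ?_)
    rwa [← mul_assoc, monomial_mul, one_mul]
  | single i n =>
    rw [← X_pow_eq_monomial] at h
    induction n with
    | zero => simpa using h
    | succ n ih => exact ih (hreg i _ (by rwa [← mul_assoc, ← pow_succ']))

theorem latticeIdeal_le {ι : Type*} (a b : ι → Fin s → ℕ)
    (hreg : ∀ i g, X i * g ∈ Ideal.span (Set.range fun j => bin K (a j) (b j)) →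
      g ∈ Ideal.span (Set.range fun j => bin K (a j) (b j))) :
    latticeIdeal K (AddSubgroup.closure (Set.range fun j => intVec (a j) - intVec (b j))) ≤
      Ideal.span (Set.range fun j => bin K (a j) (b j)) := by
  rw [latticeIdeal, Ideal.span_le]
  rintro f ⟨c, hc, rfl⟩
  obtain ⟨u, v, rfl, h⟩ := exists_bin_mem (K := K) a b c hc
  refine cancel_mono _ hreg (toFs (u ⊓ v)) _ ?_
  convert h using 1
  rw [mul_sub, mono_mul, mono_mul, bin]
  congr 3
  · congr 1
    ext i
    simp only [Pi.add_apply, Pi.inf_apply, Pi.sub_apply, intVec]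
    omega
  · congr 1
    ext i
    simp only [Pi.add_apply, Pi.inf_apply, Pi.sub_apply, intVec]
    omega

/-- The zero set condition over an arbitrary field controls the radical. -/
theorem X_mem_radical {ι : Type*} (a b : ι → Fin s → ℕ) (i : Fin s)
    (h : zeroSet (Ideal.span (Set.range fun j => bin K (a j) (b j)) ⊔ Ideal.span {X i}) = {0})
    (k : Fin s) :
    (X k : MvPolynomial (Fin s) K) ∈
      (Ideal.span (Set.range fun j => bin K (a j) (b j)) ⊔ Ideal.span {X i}).radical := by
  classical
  rw [Ideal.radical_eq_sInf, Ideal.mem_sInf]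
  rintro P ⟨hP, hprime⟩
  let e : Fin s → K := fun j => if (X j : MvPolynomial (Fin s) K) ∈ P then 0 else 1
  have hmono : ∀ c : Fin s → ℕ, eval e (monomial (toFs c) 1) =
      if monomial (toFs c) (1 : K) ∈ P then 0 else 1 := by
    intro c
    have h1 : monomial (toFs c) (1 : K) = ∏ j, X j ^ c j := by
      rw [monomial_eq, Finsupp.prod_fintype _ _ (by simp)]
      simp
    have h2 : monomial (toFs c) (1 : K) ∈ P ↔ ∃ j, X j ∈ P ∧ c j ≠ 0 := by
      rw [h1, hprime.prod_mem_iff]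
      constructor
      · rintro ⟨j, _, hj⟩
        refine ⟨j, hprime.mem_of_pow_mem _ hj, ?_⟩
        intro h0
        rw [h0, pow_zero] at hj
        exact hprime.ne_top ((Ideal.eq_top_iff_one _).2 hj)
      · rintro ⟨j, hj, hc⟩
        exact ⟨j, Finset.mem_univ _, Ideal.pow_mem_of_mem _ hj _ (Nat.pos_of_ne_zero hc)⟩
    have h3 : eval e (monomial (toFs c) (1 : K)) = ∏ j, e j ^ c j := by
      rw [h1, map_prod]; simp
    rw [h3]
    split_ifs with hc
    · obtain ⟨j, hj, hc⟩ := h2.1 hc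
      exact Finset.prod_eq_zero (Finset.mem_univ j) (by simp [e, hj, hc])
    · refine Finset.prod_eq_one fun j _ => ?_
      by_cases hj : (X j : MvPolynomial (Fin s) K) ∈ P
      · have : c j = 0 := by
          by_contra h0
          exact hc (h2.2 ⟨j, hj, h0⟩)
        simp [this]
      · simp [e, hj]
  have he : e ∈ zeroSet
      (Ideal.span (Set.range fun j => bin K (a j) (b j)) ⊔ Ideal.span {X i}) := by
    intro f hf
    have hle : Ideal.span (Set.range fun j => bin K (a j) (b j)) ⊔ Ideal.span {X i} ≤
        RingHom.ker (eval e) := by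
      refine sup_le (Ideal.span_le.2 ?_) (Ideal.span_le.2 ?_)
      · rintro _ ⟨j, rfl⟩
        have hm : bin K (a j) (b j) ∈ P := 
          hP ((le_sup_left : _ ≤ _ ⊔ Ideal.span {X i}) (Ideal.subset_span ⟨j, rfl⟩))
        rw [SetLike.mem_coe, RingHom.mem_ker, map_sub, hmono, hmono]
        have : monomial (toFs (a j)) (1 : K) ∈ P ↔ monomial (toFs (b j)) (1 : K) ∈ P :=
          ⟨fun h => by simpa using P.sub_mem h hm, fun h => by simpa using P.add_mem hm h⟩
        simp [this]
      · rintro _ rfl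
        have hm : (X i : MvPolynomial (Fin s) K) ∈ P :=
          hP ((le_sup_right : Ideal.span {X i} ≤ _) (Ideal.subset_span rfl))
        simp [e, hm]
    exact hle hf
  rw [h] at he
  by_contra hk
  have := congrFun (Set.mem_singleton_iff.1 he) k
  simp [e, hk] at this

theorem reg_X (l : List (Fin s)) (hl : l.Nodup) :
    KCx.Reg (l.map (X : Fin s → MvPolynomial (Fin s) K)) := by
  classical
  induction l with
  | nil => trivial
  | cons k l ih =>
    rw [List.nodup_cons] at hl
    refine ⟨ih hl.2, ?_⟩
    have hset : {x | x ∈ l.map (X : Fin s → MvPolynomial (Fin s) K)} = X '' {i | i ∈ l} := by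
      ext; simp
    rw [hset]
    intro g hg
    rw [mem_ideal_span_X_image] at hg ⊢
    intro m hm
    obtain ⟨i, hi, hne⟩ := hg (Finsupp.single k 1 + m) (by
      rw [mem_support_iff, coeff_X_mul]; exact mem_support_iff.1 hm)
    refine ⟨i, hi, ?_⟩
    have : k ≠ i := by rintro rfl; exact hl.1 hi
    simpa [Finsupp.single_apply, this] using hne

theorem X_regular (a b : Fin (s - 1) → Fin s → ℕ) (i : Fin s)
    (h : zeroSet (Ideal.span (Set.range fun j => bin K (a j) (b j)) ⊔ Ideal.span {X i}) = {0}) :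
    ∀ g, X i * g ∈ Ideal.span (Set.range fun j => bin K (a j) (b j)) →
      g ∈ Ideal.span (Set.range fun j => bin K (a j) (b j)) := by
  have hset : {x | x ∈ List.ofFn fun j => bin K (a j) (b j)} =
      Set.range fun j => bin K (a j) (b j) := by
    ext x; simp [List.mem_ofFn]
  have hset' : {x | x ∈ X i :: List.ofFn fun j => bin K (a j) (b j)} =
      (Set.range fun j => bin K (a j) (b j)) ∪ {X i} := by
    rw [← hset]; ext x; simp
  have key := KCx.regular_of_radical (l := List.ofFn fun j => bin K (a j) (b j)) (X i)
    (reg_X (K := K) (List.finRange s) (List.nodup_finRange s)) (by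
      have := i.pos
      simp; omega) (by
      intro t ht
      rw [hset', Ideal.span_union]
      obtain ⟨k, _, rfl⟩ := List.mem_map.1 ht
      exact X_mem_radical a b i h k)
  rwa [hset] at key

/-! ## Graded Nakayama -/

theorem comp_X_mul (w : Fin s → ℕ) (i : Fin s) (d : ℕ) (p : MvPolynomial (Fin s) K) :
    weightedHomogeneousComponent w (d + w i) (X i * p) =
      X i * weightedHomogeneousComponent w d p := by
  classical
  ext m
  rw [coeff_weightedHomogeneousComponent, coeff_X_mul', coeff_X_mul',
    coeff_weightedHomogeneousComponent]
  by_cases hi : i ∈ m.support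
  · have : Finsupp.weight w (m - Finsupp.single i 1) + w i = Finsupp.weight w m :=
      Finsupp.weight_sub_single_add (Finsupp.mem_support_iff.1 hi)
    simp only [hi, if_true, ← this, add_left_inj]
  · simp [hi]

theorem comp_X_mul' (w : Fin s → ℕ) (i : Fin s) (d : ℕ) (hd : d < w i)
    (p : MvPolynomial (Fin s) K) :
    weightedHomogeneousComponent w d (X i * p) = 0 := by
  classical
  ext m
  rw [coeff_weightedHomogeneousComponent, coeff_X_mul', coeff_zero]
  by_cases hi : i ∈ m.support
  · have : Finsupp.weight w (m - Finsupp.single i 1) + w i = Finsupp.weight w m :=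
      Finsupp.weight_sub_single_add (Finsupp.mem_support_iff.1 hi)
    rw [if_neg (by omega)]
  · simp [hi]

theorem comp_mem_span (w : Fin s → ℕ) (B : Set (MvPolynomial (Fin s) K))
    (hB : ∀ f ∈ B, ∃ e, IsWeightedHomogeneous w f e) (p : MvPolynomial (Fin s) K)
    (hp : p ∈ Ideal.span B) (d : ℕ) : weightedHomogeneousComponent w d p ∈ Ideal.span B := by
  classical
  induction hp using Submodule.span_induction generalizing d with
  | mem x hx =>
    obtain ⟨e, he⟩ := hB x hx
    rw [weightedHomogeneousComponent_of_mem he]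
    split_ifs
    · exact Ideal.subset_span hx
    · exact zero_mem _
  | zero => simp
  | add x y _ _ hx hy => rw [map_add]; exact add_mem (hx d) (hy d)
  | smul r x hx ih =>
    rw [smul_eq_mul]
    induction r using MvPolynomial.induction_on generalizing d with
    | C c =>
      rw [← smul_eq_C_mul, map_smul, smul_eq_C_mul]
      exact Ideal.mul_mem_left _ _ (ih d)
    | add p q hp hq => rw [add_mul, map_add]; exact add_mem (hp d) (hq d)
    | mul_X p i hp =>
      rw [mul_comm p, mul_assoc]
      by_cases hd : d < w i
      · rw [comp_X_mul' w i d hd]; exact zero_mem _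
      · obtain ⟨k, rfl⟩ := Nat.exists_eq_add_of_le' (not_lt.1 hd)
        rw [comp_X_mul]
        exact Ideal.mul_mem_left _ _ (hp k)

theorem graded_nakayama (w : Fin s → ℕ) (hw : ∀ i, 0 < w i) (B : Set (MvPolynomial (Fin s) K))
    (hB : ∀ f ∈ B, ∃ e, IsWeightedHomogeneous w f e) (L : Ideal (MvPolynomial (Fin s) K))
    (hL : L ≤ Ideal.span B ⊔ Ideal.span (Set.range X) * L) : L ≤ Ideal.span B := by
  have key : ∀ d, ∀ p ∈ L, weightedHomogeneousComponent w d p ∈ Ideal.span B := by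
    intro d
    induction d using Nat.strong_induction_on with
    | _ d ih =>
      have hq : ∀ q ∈ Ideal.span (Set.range X) * L,
          weightedHomogeneousComponent w d q ∈ Ideal.span B := by
        intro q hq
        induction hq using Submodule.mul_induction_on' with
        | add x _ y _ hx hy => rw [map_add]; exact add_mem hx hy
        | mem_mul_mem m hm n hn =>
          induction hm using Submodule.span_induction generalizing n with
          | zero => simp
          | add x y _ _ hx hy => rw [add_mul, map_add]; exact add_mem (hx n hn) (hy n hn)
          | smul r x _ hx =>
            rw [smul_eq_mul, mul_comm r, mul_assoc]
            exact hx _ (Ideal.mul_mem_left _ _ hn)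
          | mem x hx =>
            obtain ⟨i, rfl⟩ := hx
            by_cases hd : d < w i
            · rw [comp_X_mul' w i d hd]; exact zero_mem _
            · obtain ⟨k, rfl⟩ := Nat.exists_eq_add_of_le' (not_lt.1 hd)
              rw [comp_X_mul]
              exact Ideal.mul_mem_left _ _ (ih k (by have := hw i; omega) n hn)
      intro p hp
      obtain ⟨j, hj, q, hq', rfl⟩ := Submodule.mem_sup.1 (hL hp)
      rw [map_add]
      exact add_mem (comp_mem_span w B hB j hj d) (hq q hq')
  intro p hp
  rw [← sum_weightedHomogeneousComponent w p]
  exact finsum_induction (· ∈ Ideal.span B) (zero_mem _) (fun _ _ => add_mem)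
    fun d => key d p hp

theorem sub_C_mem (r : MvPolynomial (Fin s) K) :
    r - C (constantCoeff r) ∈ Ideal.span (Set.range (X : Fin s → MvPolynomial (Fin s) K)) := by
  classical
  rw [← Set.image_univ, mem_ideal_span_X_image]
  intro m hm
  by_contra! h
  obtain rfl : m = 0 := by ext i; simpa using h i (Set.mem_univ i)
  rw [mem_support_iff] at hm
  apply hm
  simp [constantCoeff_eq]

theorem exists_gens (L : Ideal (MvPolynomial (Fin s) K)) (B : Set (MvPolynomial (Fin s) K))
    (hB : L = Ideal.span B) (h0 : 0 ∈ B) {n : ℕ} (g : Fin n → MvPolynomial (Fin s) K)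
    (hg : L = Ideal.span (Set.range g)) :
    ∃ h : Fin n → MvPolynomial (Fin s) K, (∀ j, h j ∈ B) ∧
      L ≤ Ideal.span (Set.range h) ⊔ Ideal.span (Set.range X) * L := by
  let N : Submodule K (MvPolynomial (Fin s) K) :=
    (Ideal.span (Set.range X) * L).restrictScalars K
  let q := N.mkQ
  have hspan : ∀ A : Set (MvPolynomial (Fin s) K), L = Ideal.span A →
      Submodule.map q (L.restrictScalars K) = Submodule.span K (q '' A) := by
    intro A hA
    apply le_antisymm
    · rintro _ ⟨x, hx, rfl⟩
      have hx' : x ∈ Ideal.span A := hA ▸ hx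
      clear hx
      induction hx' using Submodule.span_induction with
      | mem x hx => exact Submodule.subset_span ⟨x, hx, rfl⟩
      | zero => rw [map_zero]; exact zero_mem _
      | add x y _ _ hx hy => rw [map_add]; exact add_mem hx hy
      | smul r x hx ih =>
        have : q (r • x) = constantCoeff r • q x := by
          rw [← map_smul, ← sub_eq_zero, ← map_sub]
          refine (Submodule.Quotient.mk_eq_zero N).2 ?_
          change r * x - constantCoeff r • x ∈ Ideal.span (Set.range X) * L
          rw [smul_eq_C_mul, ← sub_mul]
          exact Ideal.mul_mem_mul (sub_C_mem r) (hA ▸ hx)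
        rw [this]
        exact Submodule.smul_mem _ _ ih
    · rw [Submodule.span_le]
      rintro _ ⟨x, hx, rfl⟩
      refine ⟨x, ?_, rfl⟩
      change x ∈ L
      rw [hA]
      exact Ideal.subset_span hx
  have hBg : Submodule.span K (q '' B) = Submodule.span K (Set.range (q ∘ g)) := by
    rw [Set.range_comp, ← hspan B hB, hspan _ hg]
  have hfin : Module.Finite K (Submodule.span K (q '' B)) := by
    rw [hBg]
    exact Module.Finite.span_of_finite K (Set.finite_range _)
  have hrank : Module.finrank K (Submodule.span K (q '' B)) ≤ n := by
    rw [hBg]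
    exact (finrank_range_le_card (R := K) (q ∘ g)).trans (by simp)
  obtain ⟨f, hf, hfs, -⟩ := Submodule.exists_fun_fin_finrank_span_eq K (q '' B)
  choose b hb hbf using hf
  refine ⟨fun j => if hj : j.1 < Module.finrank K (Submodule.span K (q '' B)) then b ⟨j, hj⟩ else 0,
    ?_, ?_⟩
  · intro j
    dsimp only
    split_ifs
    · exact hb _
    · exact h0
  · intro x hx
    have h1 : q x ∈ Submodule.span K (Set.range f) := by
      rw [hfs, ← hspan B hB]
      exact ⟨x, hx, rfl⟩
    have h2 : f = q ∘ b := funext fun i => (hbf i).symm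
    rw [h2, Set.range_comp, Submodule.span_image] at h1
    obtain ⟨y, hy, hyx⟩ := h1
    have h3 : x - y ∈ Ideal.span (Set.range X) * L := by
      refine (Submodule.Quotient.mk_eq_zero N).1 ?_
      change q (x - y) = 0
      rw [map_sub, hyx, sub_self]
    rw [← add_sub_cancel y x]
    refine add_mem (Ideal.mem_sup_left ?_) (Ideal.mem_sup_right h3)
    have hle : Submodule.span K (Set.range b) ≤ (Ideal.span (Set.range fun j : Fin n =>
        if hj : j.1 < Module.finrank K (Submodule.span K (q '' B)) then b ⟨j, hj⟩
          else 0)).restrictScalars K := by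
      rw [Submodule.span_le]
      rintro _ ⟨i, rfl⟩
      exact Ideal.subset_span ⟨⟨i, i.2.trans_le hrank⟩, by simp⟩
    exact hle hy

theorem bin_homog (w : Fin s → ℕ) (a b : Fin s → ℕ) (h : ∑ i, a i * w i = ∑ i, b i * w i) :
    IsWeightedHomogeneous w (bin K a b) (∑ i, a i * w i) := by
  have hwt : ∀ c : Fin s → ℕ, Finsupp.weight w (toFs c) = ∑ i, c i * w i := by
    intro c
    rw [Finsupp.weight_apply, Finsupp.sum_fintype _ _ (by simp)]
    simp
  refine (weightedHomogeneousSubmodule K w _).sub_mem ?_ ?_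
  · exact isWeightedHomogeneous_monomial _ _ _ (hwt a)
  · exact isWeightedHomogeneous_monomial _ _ _ ((hwt b).trans h.symm)

end Lattice

theorem ci_criterion_for_one_dim_graded_lattice_ideals {s : ℕ} {K : Type*} [Field K]
    (w : Fin s → ℕ) (hw : ∀ i, 0 < w i)
    (𝓛 : AddSubgroup (Fin s → ℤ)) (hhom : ∀ a ∈ 𝓛, ∑ i, a i * (w i : ℤ) = 0)
    (L : Ideal (MvPolynomial (Fin s) K)) (hL : L = latticeIdeal K 𝓛)
    (hV : ∀ i : Fin s, zeroSet (L ⊔ Ideal.span {X i}) = {0}) :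
    (∃ g : Fin (s - 1) → MvPolynomial (Fin s) K, L = Ideal.span (Set.range g)) ↔
      ∃ a b : Fin (s - 1) → Fin s → ℕ,
        (∀ j, monomial (toFs (a j)) (1 : K) - monomial (toFs (b j)) 1 ∈ L) ∧
        (∀ j, ∑ i, a j i * w i = ∑ i, b j i * w i) ∧
        𝓛 = AddSubgroup.closure (Set.range fun j => intVec (a j) - intVec (b j)) ∧
        ∀ i : Fin s, zeroSet
          (Ideal.span (Set.range fun j =>
            monomial (toFs (a j)) (1 : K) - monomial (toFs (b j)) 1) ⊔
            Ideal.span {X i}) = {0} := by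
  constructor
  · rintro ⟨g, hg⟩
    obtain ⟨h, hh, hle⟩ := exists_gens L _ hL ⟨0, zero_mem _, by simp⟩ g hg
    choose c hc hhc using hh
    have hdeg : ∀ j, ∑ i, (c j i).toNat * w i = ∑ i, (-c j i).toNat * w i := by
      intro j
      have h1 := hhom _ (hc j)
      zify
      rw [← sub_eq_zero, ← Finset.sum_sub_distrib, ← h1]
      refine Finset.sum_congr rfl fun i _ => ?_
      rw [← sub_mul]
      congr 1
      omega
    have hLh : L = Ideal.span (Set.range h) := by
      apply le_antisymm
      · refine graded_nakayama w hw _ ?_ L hle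
        rintro _ ⟨j, rfl⟩
        rw [hhc]
        exact ⟨_, bin_homog w _ _ (hdeg j)⟩
      · rw [Ideal.span_le]
        rintro _ ⟨j, rfl⟩
        rw [hhc, hL]
        exact Ideal.subset_span ⟨c j, hc j, rfl⟩
    have hfun : h = fun j => bin K (fun i => (c j i).toNat) (fun i => (-c j i).toNat) :=
      funext hhc
    refine ⟨fun j i => (c j i).toNat, fun j i => (-c j i).toNat, ?_, hdeg, ?_, ?_⟩
    · intro j
      rw [hL]
      exact Ideal.subset_span ⟨c j, hc j, rfl⟩
    · apply le_antisymm
      · intro x hx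
        have hm : bin K (fun i => (x i).toNat) (fun i => (-x i).toNat) ∈
            Ideal.span (Set.range h) := by
          rw [← hLh, hL]
          exact Ideal.subset_span ⟨x, hx, rfl⟩
        rw [← intVec_pos_sub_neg x]
        refine mem_of_bin_mem _ _ ?_ _ _ hm
        rintro _ ⟨j, rfl⟩
        exact ⟨_, _, hhc j, AddSubgroup.subset_closure ⟨j, rfl⟩⟩
      · rw [AddSubgroup.closure_le]
        rintro _ ⟨j, rfl⟩
        simp only [intVec_pos_sub_neg]
        exact hc j
    · intro i
      have := hV i
      rw [hLh, hfun] at this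
      exact this
  · rintro ⟨a, b, hmem, -, hcl, hz⟩
    refine ⟨fun j => bin K (a j) (b j), le_antisymm ?_ ?_⟩
    · rw [hL, hcl]
      exact latticeIdeal_le a b fun i => X_regular a b i (hz i)
    · rw [Ideal.span_le]
      rintro _ ⟨j, rfl⟩
      exact hmem j
end
end

section
/- Let K be a field of characteristic zero and L ⊂ S an arbitrary lattice ideal of height r. If rad(L) = rad((g_1,...,g_r)) for some binomials g_1,...,g_r, then L = (g_1,...,g_r). In particular, a lattice ideal in characteristic zero which is a binomial set theoretic complete intersection is a complete intersection. -/
open MvPolynomial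

noncomputable section

namespace CMAux

open RingTheory.Sequence IsLocalRing Pointwise

universe u

set_option linter.unusedSectionVars false


/-- depth at least `n` -/
def HasDepth (A : Type u) [CommRing A] [IsLocalRing A] (M : Type u) [AddCommGroup M] [Module A M]
    (n : ℕ) : Prop :=
  ∃ rs : List A, rs.length = n ∧ (∀ r ∈ rs, r ∈ maximalIdeal A) ∧ IsRegular M rs

variable {A : Type u} [CommRing A] [IsLocalRing A] [IsNoetherianRing A]

lemma smul_lt (M : Type u) [AddCommGroup M] [Module A M] [Module.Finite A M] [Nontrivial M] :
    maximalIdeal A • (⊤ : Submodule A M) < ⊤ := by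
  refine lt_top_iff_ne_top.2 (Ne.symm ?_)
  exact Submodule.top_ne_ideal_smul_of_le_jacobson_annihilator (maximalIdeal_le_jacobson _)

open CategoryTheory Abelian in
lemma HasDepth.quot {M : Type u} [AddCommGroup M] [Module A M] [Module.Finite A M] {n : ℕ}
    (h : HasDepth A M (n + 1)) {x : A} (hx : x ∈ maximalIdeal A) (hr : IsSMulRegular M x) :
    HasDepth A (QuotSMulTop x M) n := by
  have hM : Nontrivial M := by
    obtain ⟨rs, -, -, h⟩ := h
    exact h.nontrivial
  have : Nontrivial (QuotSMulTop x M) := nontrivial_quotSMulTop_of_mem_maximalIdeal M hx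
  have h1 := ((ModuleCat.exists_isRegular_tfae (maximalIdeal A) (n+1) (ModuleCat.of A M)
    (smul_lt M)).out 3 1).1 h
  refine ((ModuleCat.exists_isRegular_tfae (maximalIdeal A) n (ModuleCat.of A (QuotSMulTop x M))
    (smul_lt _)).out 1 3).1 ?_
  intro i hi
  have zero1 := AddCommGrpCat.isZero_of_iff_subsingleton.mpr (h1 i (by omega))
  have zero2 := AddCommGrpCat.isZero_of_iff_subsingleton.mpr (h1 (i + 1) (by omega))
  have hr' : IsSMulRegular (ModuleCat.of A M) x := hr
  exact AddCommGrpCat.subsingleton_of_isZero <| ShortComplex.Exact.isZero_of_both_zeros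
        ((Ext.covariant_sequence_exact₃' _ hr'.smulShortComplex_shortExact) i (i + 1) rfl)
        (zero1.eq_zero_of_src _) (zero2.eq_zero_of_tgt _)

lemma dim_lt {p q : Ideal A} [p.IsPrime] [q.IsPrime] (h : p < q) :
    ringKrullDim (A ⧸ q) + 1 ≤ ringKrullDim (A ⧸ p) := by
  obtain ⟨x, hxq, hxp⟩ := SetLike.exists_of_lt h
  refine ringKrullDim_succ_le_of_surjective (Ideal.Quotient.factor h.le)
    (Ideal.Quotient.factor_surjective h.le) (r := Ideal.Quotient.mk p x) ?_ ?_
  · exact mem_nonZeroDivisors_of_ne_zero (by simpa [Ideal.Quotient.eq_zero_iff_mem] using hxp)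
  · simpa [Ideal.Quotient.eq_zero_iff_mem] using hxq

lemma HasDepth.le_dim {n : ℕ} : ∀ {M : Type u} [AddCommGroup M] [Module A M] [Module.Finite A M]
    (_ : HasDepth A M n) {p : Ideal A} (_ : p ∈ associatedPrimes A M),
    (n : WithBot ℕ∞) ≤ ringKrullDim (A ⧸ p) := by
  induction n with
  | zero =>
    intro M _ _ _ h p hp
    have : p.IsPrime := hp.isPrime
    exact ringKrullDim_nonneg_of_nontrivial
  | succ n ih =>
    intro M _ _ _ h p hp
    have hpp : p.IsPrime := hp.isPrime
    obtain ⟨rs, hl, hm, hreg⟩ := h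
    match rs with
    | [] => simp at hl
    | x :: rs =>
      simp only [isRegular_cons_iff] at hreg
      simp only [List.mem_cons, forall_eq_or_imp] at hm
      have hd : HasDepth A (QuotSMulTop x M) n := ⟨rs, by simpa using hl, hm.2, hreg.2⟩
      -- the submodule killed by p
      let N : Submodule A M := 
        { carrier := {m | ∀ a ∈ p, a • m = 0}
          add_mem' := by
            intro a b ha hb c hc
            rw [smul_add, ha c hc, hb c hc, add_zero]
          zero_mem' := by simp
          smul_mem' := by
            intro c m hm a ha
            rw [smul_comm, hm a ha, smul_zero] }
      obtain ⟨hp1, y, hy⟩ := isAssociatedPrime_iff.1 hp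
      have hyN : y ∈ N := by
        intro a ha
        rw [hy, Submodule.mem_colon_singleton] at ha
        simpa using ha
      have hy0 : y ≠ 0 := by
        rintro rfl
        apply hpp.ne_top
        rw [hy, Ideal.eq_top_iff_one, Submodule.mem_colon_singleton]
        simp
      have hN : ¬ N ≤ x • (⊤ : Submodule A M) := by
        intro hle
        have : N ≤ maximalIdeal A • N := by
          intro m hmN
          obtain ⟨m', -, rfl⟩ := hle hmN
          refine Submodule.smul_mem_smul hm.1 ?_
          intro a ha
          have := hmN a ha
          simp only [DistribSMul.toLinearMap_apply] at this
          rw [smul_comm] at this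
          exact hreg.1.right_eq_zero_of_smul this
        have hb := Submodule.eq_bot_of_le_smul_of_le_jacobson_bot (maximalIdeal A) N
          (IsNoetherian.noetherian N) this (maximalIdeal_le_jacobson _)
        rw [hb] at hyN
        exact hy0 (by simpa using hyN)
      obtain ⟨z, hzN, hz⟩ := SetLike.not_le_iff_exists.1 hN
      obtain ⟨q, hq, hzq⟩ := exists_le_isAssociatedPrime_of_isNoetherianRing A
        (Submodule.Quotient.mk z : QuotSMulTop x M) (by
          intro h0; exact hz ((Submodule.Quotient.mk_eq_zero _).1 h0))
      have hqp : q.IsPrime := hq.isPrime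
      have hpq : p ≤ q := by
        intro a ha
        apply hzq
        rw [Submodule.mem_colon_singleton, ← Submodule.Quotient.mk_smul, hzN a ha]
        simp
      have hxq : x ∈ q := by
        apply hzq
        rw [Submodule.mem_colon_singleton, ← Submodule.Quotient.mk_smul]
        simp only [Submodule.mem_bot]
        exact (Submodule.Quotient.mk_eq_zero _).2 (Submodule.smul_mem_pointwise_smul _ _ _ trivial)
      have hxp : x ∉ p := by
        intro hxp
        exact hy0 (hreg.1.right_eq_zero_of_smul (hyN x hxp))
      have hlt : p < q := lt_of_le_of_ne hpq (by rintro rfl; exact hxp hxq)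
      refine le_trans ?_ (dim_lt hlt)
      push_cast
      gcongr
      exact ih hd hq


lemma HasDepth.congr {M N : Type u} [AddCommGroup M] [Module A M] [AddCommGroup N] [Module A N]
    (e : M ≃ₗ[A] N) {n : ℕ} (h : HasDepth A M n) : HasDepth A N n := by
  obtain ⟨rs, h1, h2, h3⟩ := h
  exact ⟨rs, h1, h2, (e.isRegular_congr rs).1 h3⟩

lemma supportDim_le (gs : List A) (hgs : ∀ g ∈ gs, g ∈ maximalIdeal A) :
    ∀ {M : Type u} [AddCommGroup M] [Module A M] [Module.Finite A M],
    Module.supportDim A M ≤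
      Module.supportDim A (M ⧸ Ideal.ofList gs • (⊤ : Submodule A M)) + gs.length := by
  induction gs with
  | nil =>
    intro M _ _ _
    have h0 : (Ideal.ofList ([] : List A)) • (⊤ : Submodule A M) = ⊥ := by
      rw [Ideal.ofList_nil, Submodule.bot_smul]
    have := Module.supportDim_eq_of_equiv (Submodule.quotEquivOfEqBot _ h0)
    rw [this]
    simp
  | cons g gs ih =>
    intro M _ _ _
    simp only [List.mem_cons, forall_eq_or_imp] at hgs
    rw [Module.supportDim_eq_of_equiv (Submodule.quotOfListConsSMulTopEquivQuotSMulTopInner M g gs)]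
    refine (Module.supportDim_le_supportDim_quotSMulTop_succ hgs.1).trans ?_
    have := ih hgs.2 (M := QuotSMulTop g M)
    rw [List.length_cons]
    push_cast
    rw [← add_assoc]
    gcongr

lemma HasDepth.quot_list (gs : List A) (hgs : ∀ g ∈ gs, g ∈ maximalIdeal A) :
    ∀ {M : Type u} [AddCommGroup M] [Module A M] [Module.Finite A M] {n : ℕ}
    (_ : HasDepth A M n)
    (_ : Module.supportDim A (M ⧸ Ideal.ofList gs • (⊤ : Submodule A M)) + gs.length ≤ n),
    ∃ k, k + gs.length = n ∧ HasDepth A (M ⧸ Ideal.ofList gs • (⊤ : Submodule A M)) k := by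
  induction gs with
  | nil =>
    intro M _ _ _ n h _
    exact ⟨n, by simp, h.congr
      (Submodule.quotEquivOfEqBot (Ideal.ofList [] • (⊤ : Submodule A M))
        (by rw [Ideal.ofList_nil, Submodule.bot_smul])).symm⟩
  | cons g gs ih =>
    intro M _ _ _ n h hd
    have hM : Nontrivial M := by
      obtain ⟨rs, -, -, h⟩ := h
      exact h.nontrivial
    have hnt : Nontrivial (M ⧸ Ideal.ofList (g :: gs) • (⊤ : Submodule A M)) := by
      refine Submodule.Quotient.nontrivial_iff.2 (Ne.symm ?_)
      refine Submodule.top_ne_ideal_smul_of_le_jacobson_annihilator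
        (le_trans ?_ (maximalIdeal_le_jacobson _))
      exact Ideal.span_le.2 hgs
    simp only [List.mem_cons, forall_eq_or_imp] at hgs
    by_cases hg : IsSMulRegular M g
    · rw [Module.supportDim_eq_of_equiv
        (Submodule.quotOfListConsSMulTopEquivQuotSMulTopInner M g gs)] at hd
      have hnt' := (Submodule.quotOfListConsSMulTopEquivQuotSMulTopInner M g gs).symm.toEquiv.nontrivial
      obtain ⟨n, rfl⟩ : ∃ m, n = m + 1 := by
        cases n with
        | zero =>
          exfalso
          have h0 := Module.supportDim_ne_bot_of_nontrivial A
            (QuotSMulTop g M ⧸ Ideal.ofList gs • (⊤ : Submodule A (QuotSMulTop g M)))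
          obtain ⟨c, hc⟩ := WithBot.ne_bot_iff_exists.1 h0
          rw [← hc] at hd
          simp only [List.length_cons] at hd
          norm_cast at hd
          simp at hd
        | succ m => exact ⟨m, rfl⟩
      have h2 : Module.supportDim A (QuotSMulTop g M ⧸
          Ideal.ofList gs • (⊤ : Submodule A (QuotSMulTop g M))) + gs.length ≤ n := by
        have h0 := Module.supportDim_ne_bot_of_nontrivial A
            (QuotSMulTop g M ⧸ Ideal.ofList gs • (⊤ : Submodule A (QuotSMulTop g M)))
        obtain ⟨c, hc⟩ := WithBot.ne_bot_iff_exists.1 h0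
        rw [← hc] at hd ⊢
        simp only [List.length_cons] at hd
        norm_cast at hd ⊢
        push_cast at hd
        rw [← add_assoc] at hd
        exact (ENat.add_le_add_iff_right ENat.one_ne_top).1 hd
      obtain ⟨k, hk, hk'⟩ := ih hgs.2 (h.quot hgs.1 hg) h2
      exact ⟨k, by simp; omega, hk'.congr
        (Submodule.quotOfListConsSMulTopEquivQuotSMulTopInner M g gs).symm⟩
    · exfalso
      have : g ∈ ⋃ p ∈ associatedPrimes A M, (p : Set A) := by
        rw [biUnion_associatedPrimes_eq_compl_regular]
        exact hg
      simp only [Set.mem_iUnion, SetLike.mem_coe] at this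
      obtain ⟨p, hp, hgp⟩ := this
      have hpp : p.IsPrime := hp.isPrime
      have h1 := h.le_dim hp
      rw [← Module.supportDim_quotient_eq_ringKrullDim] at h1
      have h2 := h1.trans (supportDim_le gs hgs.2 (M := A ⧸ p))
      have h3 : Module.supportDim A ((A ⧸ p) ⧸ Ideal.ofList gs • (⊤ : Submodule A (A ⧸ p))) ≤
          Module.supportDim A (M ⧸ Ideal.ofList (g :: gs) • (⊤ : Submodule A M)) := by
        have hsub : Module.support A ((A ⧸ p) ⧸ Ideal.ofList gs • (⊤ : Submodule A (A ⧸ p))) ⊆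
            Module.support A (M ⧸ Ideal.ofList (g :: gs) • (⊤ : Submodule A M)) := by
          rw [Module.support_quotient, Module.support_quotient]
          rintro q ⟨hq1, hq2⟩
          rw [Module.support_eq_zeroLocus, Ideal.annihilator_quotient] at hq1
          refine ⟨?_, ?_⟩
          · rw [Module.support_eq_zeroLocus]
            have h9 := (hp.annihilator_le).trans hq1
            rwa [Submodule.annihilator_top] at h9
          · simp only [PrimeSpectrum.mem_zeroLocus, SetLike.coe_subset_coe, Ideal.ofList_cons,
              sup_le_iff] at hq1 hq2 ⊢
            exact ⟨(Ideal.span_singleton_le_iff_mem _).2 (hq1 hgp), hq2⟩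
        exact Order.krullDim_le_of_strictMono (fun a ↦ ⟨a.1, hsub a.2⟩) (fun {_ _} lt ↦ lt)
      have h4 : Module.supportDim A (M ⧸ Ideal.ofList (g :: gs) • (⊤ : Submodule A M)) +
          (g :: gs).length ≤ 
          Module.supportDim A (M ⧸ Ideal.ofList (g :: gs) • (⊤ : Submodule A M)) +
          gs.length := by
        refine hd.trans (h2.trans ?_)
        gcongr
      have h5 : Module.supportDim A (M ⧸ Ideal.ofList (g :: gs) • (⊤ : Submodule A M)) ≤ n := by
        refine le_trans ?_ hd
        exact le_add_of_nonneg_right (by positivity)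
      obtain ⟨c, hc⟩ := WithBot.ne_bot_iff_exists.1 (Module.supportDim_ne_bot_of_nontrivial A
        (M ⧸ Ideal.ofList (g :: gs) • (⊤ : Submodule A M)))
      rw [← hc] at h4 h5
      simp only [List.length_cons] at h4
      norm_cast at h4 h5
      lift c to ℕ using (ne_top_of_le_ne_top (ENat.natCast_ne_top n) h5)
      norm_cast at h4
      omega


lemma height_add_dim_le {A : Type u} [CommRing A] {I : Ideal A} {r : ℕ}
    (h : ∀ q : PrimeSpectrum A, I ≤ q.asIdeal → (r : ℕ∞) ≤ Order.height q) :
    ringKrullDim (A ⧸ I) + r ≤ ringKrullDim A := by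
  by_cases hI : I = ⊤
  · subst hI
    have : Subsingleton (A ⧸ (⊤ : Ideal A)) := Ideal.Quotient.subsingleton_iff.2 rfl
    rw [ringKrullDim_eq_bot_of_subsingleton]
    simp
  have : Nonempty (PrimeSpectrum.zeroLocus (I : Set A)) := by
    obtain ⟨m, hm, hle⟩ := Ideal.exists_le_maximal I hI
    exact ⟨⟨⟨m, hm.isPrime⟩, hle⟩⟩
  have : Nonempty (PrimeSpectrum A) := ⟨this.some.1⟩
  rw [ringKrullDim_quotient, ringKrullDim, Order.krullDim_eq_iSup_length,
    Order.krullDim_eq_iSup_height_add_coheight_of_nonempty]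
  norm_cast
  rw [ENat.iSup_add]
  refine iSup_le fun l => ?_
  refine le_trans ?_ (le_iSup _ (l.head : PrimeSpectrum A))
  rw [add_comm]
  gcongr
  · exact h _ l.head.2
  · exact Order.length_le_coheight (p := l.map Subtype.val (fun _ _ ↦ id)) le_rfl

theorem regular_aux (n : ℕ) : ∀ (A : Type u) [CommRing A] [IsRegularLocalRing A],
    ringKrullDim A = n → IsDomain A ∧ HasDepth A A n := by
  induction n with
  | zero =>
    intro A _ _ h
    have h1 := (isRegularLocalRing_iff A).1 inferInstance
    rw [h] at h1
    have h2 : (maximalIdeal A).spanFinrank = 0 := by exact_mod_cast h1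
    have h3 : maximalIdeal A = ⊥ := by
      have := (Submodule.spanFinrank_eq_zero_iff_eq_bot (IsNoetherian.noetherian (maximalIdeal A))).1 h2
      exact this
    have hf := (IsLocalRing.isField_iff_maximalIdeal_eq).2 h3
    exact ⟨hf.isDomain, [], rfl, by simp, IsRegular.nil _ _⟩
  | succ n ih =>
    intro A _ _ hdim
    have h1 := (isRegularLocalRing_iff A).1 inferInstance
    rw [hdim] at h1
    have h2 : (maximalIdeal A).spanFinrank = n + 1 := by exact_mod_cast h1
    have hfg := IsNoetherian.noetherian (maximalIdeal A)
    -- choose an element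
    have hx : ∃ x ∈ maximalIdeal A, x ∉ (maximalIdeal A) ^ 2 ∧ ∀ q ∈ minimalPrimes A, x ∉ q := by
      by_contra! hcon
      have hfin := minimalPrimes.finite_of_isNoetherianRing A
      have hs : ((maximalIdeal A : Ideal A) : Set A) ⊆
          ⋃ i ∈ (↑(insert ((maximalIdeal A) ^ 2) hfin.toFinset) : Set (Ideal A)), (i : Set A) := by
        intro x hx
        by_cases hx2 : x ∈ (maximalIdeal A) ^ 2
        · simp only [Finset.coe_insert, Set.mem_iUnion]
          exact ⟨_, Set.mem_insert _ _, hx2⟩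
        · obtain ⟨q, hq, hxq⟩ := hcon x hx hx2
          simp only [Finset.coe_insert, Set.mem_iUnion]
          exact ⟨q, Set.mem_insert_of_mem _ (by simpa using hq), hxq⟩
      replace hs := (Ideal.subset_union_prime (f := id) ((maximalIdeal A) ^ 2)
        ((maximalIdeal A) ^ 2) ?_).1 hs
      · obtain ⟨i, hi, hle⟩ := hs
        rw [Finset.mem_insert] at hi
        rcases hi with rfl | hi
        · have : maximalIdeal A = ⊥ := by
            refine Submodule.eq_bot_of_le_smul_of_le_jacobson_bot (maximalIdeal A) _ hfg ?_
              (maximalIdeal_le_jacobson _)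
            simpa [pow_two] using hle
          rw [this] at h2
          simp at h2
        · have hi' : i ∈ minimalPrimes A := by simpa using hi
          have hip : i.IsPrime := hi'.1.1
          have hh : (maximalIdeal A).height = 0 := by
            have : maximalIdeal A = i := le_antisymm hle (le_maximalIdeal hip.ne_top)
            rw [this]
            exact Ideal.height_eq_zero_iff.2 hi'
          have := IsLocalRing.maximalIdeal_height_eq_ringKrullDim (R := A)
          rw [hh, hdim] at this
          norm_cast at this
      · intro i hi h _
        rw [Finset.mem_insert] at hi
        have hi' : i ∈ minimalPrimes A := by simpa [h] using hi
        exact hi'.1.1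
    obtain ⟨x, hxm, hx2, hxq⟩ := hx
    have hnt : Nontrivial (A ⧸ Ideal.span {x}) :=
      Ideal.Quotient.nontrivial_iff.2 (by
        intro h
        have := (Ideal.span_singleton_le_iff_mem _).2 hxm
        rw [h] at this
        exact (maximalIdeal.isMaximal A).ne_top (top_le_iff.1 this))
    have hloc : IsLocalRing (A ⧸ Ideal.span {x}) :=
      IsLocalRing.of_surjective' (Ideal.Quotient.mk _) Ideal.Quotient.mk_surjective
    -- dimension
    have hd1 : ringKrullDim (A ⧸ Ideal.span {x}) = n := by
      have h4 := Module.supportDim_quotSMulTop_succ_eq_of_notMem_minimalPrimes_of_mem_maximalIdeal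
        (M := A) (x := x) (by
          have : Module.annihilator A A = ⊥ := Module.annihilator_eq_bot.mpr
            ((faithfulSMul_iff_algebraMap_injective A A).mpr fun {a₁ a₂} a ↦ a)
          rw [this]
          exact hxq) hxm
      rw [Module.supportDim_self_eq_ringKrullDim, hdim] at h4
      have heq : Ideal.span {x} = x • (⊤ : Ideal A) := by
        simp [← Submodule.ideal_span_singleton_smul]
      rw [← Module.supportDim_eq_of_equiv (Submodule.quotEquivOfEq _ _ heq),
        Module.supportDim_quotient_eq_ringKrullDim] at h4
      obtain ⟨c, hc⟩ := WithBot.ne_bot_iff_exists.1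
        (ne_bot_of_le_ne_bot WithBot.zero_ne_bot
          (ringKrullDim_nonneg_of_nontrivial (R := A ⧸ Ideal.span {x})))
      rw [← hc] at h4 ⊢
      norm_cast at h4 ⊢
      push_cast at h4
      exact ENat.add_left_injective_of_ne_top ENat.one_ne_top h4
    have hmm : maximalIdeal (A ⧸ Ideal.span {x}) =
        (maximalIdeal A).map (Ideal.Quotient.mk (Ideal.span {x})) := by
      refine (IsLocalRing.eq_maximalIdeal ?_).symm
      refine (Ideal.map_eq_top_or_isMaximal_of_surjective _ Ideal.Quotient.mk_surjective
        (maximalIdeal.isMaximal A)).resolve_left ?_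
      intro htop
      have := Ideal.comap_map_of_surjective (Ideal.Quotient.mk (Ideal.span {x}))
        Ideal.Quotient.mk_surjective (maximalIdeal A)
      rw [htop, ← RingHom.ker_eq_comap_bot, Ideal.mk_ker, Ideal.comap_top,
        sup_eq_left.2 ((Ideal.span_singleton_le_iff_mem _).2 hxm)] at this
      exact (maximalIdeal.isMaximal A).ne_top this.symm
    have hreg : IsRegularLocalRing (A ⧸ Ideal.span {x}) := by
      apply IsRegularLocalRing.of_spanFinrank_maximalIdeal_le
      rw [hd1]
      have hgf := hfg.finite_generators
      set F := hgf.toFinset with hF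
      have hFspan : Ideal.span (F : Set A) = maximalIdeal A := by
        rw [hF, Set.Finite.coe_toFinset]
        exact Submodule.span_generators _
      have hFc : F.card = n + 1 := by
        rw [hF, ← Set.ncard_eq_toFinset_card _ hgf, hfg.generators_ncard, h2]
      have hxs := hxm
      rw [← hFspan] at hxs
      obtain ⟨c, -, hc⟩ := Submodule.mem_span_finset.1 hxs
      have hFm : ∀ s ∈ F, s ∈ maximalIdeal A := fun s hs => by
        rw [← hFspan]; exact Ideal.subset_span hs
      obtain ⟨s, hs, hcs⟩ : ∃ s ∈ F, IsUnit (c s) := by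
        by_contra! hcon
        apply hx2
        rw [← hc]
        refine Ideal.sum_mem _ fun s hs => ?_
        rw [pow_two]
        exact Ideal.mul_mem_mul (hcon s hs) (hFm s hs)
      classical
      have hle : (maximalIdeal A).map (Ideal.Quotient.mk (Ideal.span {x})) =
          Ideal.span (((F.erase s).image (Ideal.Quotient.mk (Ideal.span {x})) : Finset _) :
            Set (A ⧸ Ideal.span {x})) := by
        apply le_antisymm
        · rw [← hFspan, Ideal.map_span, Ideal.span_le]
          have hne : ∀ t ∈ F, t ≠ s → Ideal.Quotient.mk (Ideal.span {x}) t ∈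
              Ideal.span (((F.erase s).image (Ideal.Quotient.mk (Ideal.span {x})) : Finset _) :
                Set (A ⧸ Ideal.span {x})) := by
            intro t ht hts
            apply Ideal.subset_span
            exact Finset.mem_coe.2 (Finset.mem_image_of_mem _ (Finset.mem_erase.2 ⟨hts, ht⟩))
          rintro _ ⟨t, ht, rfl⟩
          by_cases hts : t = s
          · subst hts
            have h6 : Ideal.Quotient.mk (Ideal.span {x}) (c t) *
                Ideal.Quotient.mk (Ideal.span {x}) t =
                - ∑ a ∈ F.erase t, Ideal.Quotient.mk (Ideal.span {x}) (c a) *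
                  Ideal.Quotient.mk (Ideal.span {x}) a := by
              have h7 : Ideal.Quotient.mk (Ideal.span {x}) x = 0 :=
                Ideal.Quotient.eq_zero_iff_mem.2 (Ideal.mem_span_singleton_self x)
              rw [eq_neg_iff_add_eq_zero, Finset.add_sum_erase F
                (fun a => Ideal.Quotient.mk (Ideal.span {x}) (c a) *
                  Ideal.Quotient.mk (Ideal.span {x}) a) hs]
              have h8 := congrArg (Ideal.Quotient.mk (Ideal.span {x})) hc
              rw [h7, map_sum] at h8
              simpa using h8
            have h8 := hcs.map (Ideal.Quotient.mk (Ideal.span {x}))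
            refine (Ideal.unit_mul_mem_iff_mem _ h8).1 ?_
            rw [h6]
            refine neg_mem (Ideal.sum_mem _ fun a ha => Ideal.mul_mem_left _ _ ?_)
            exact hne a (Finset.mem_of_mem_erase ha) (Finset.ne_of_mem_erase ha)
          · exact hne t ht hts
        · rw [Ideal.span_le]
          intro y hy
          obtain ⟨t, ht, rfl⟩ := Finset.mem_image.1 (Finset.mem_coe.1 hy)
          exact Ideal.mem_map_of_mem _ (hFm t (Finset.mem_of_mem_erase ht))
      rw [hmm, hle]
      have h9 := Submodule.spanFinrank_span_le_ncard_of_finite (R := A ⧸ Ideal.span {x})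
        (Finset.finite_toSet ((F.erase s).image (Ideal.Quotient.mk (Ideal.span {x}))))
      rw [Set.ncard_coe_finset] at h9
      have h10 := h9.trans Finset.card_image_le
      rw [Finset.card_erase_of_mem hs, hFc] at h10
      exact_mod_cast h10
    obtain ⟨hdom, rs, hlen, hmem, hrs⟩ := ih (A ⧸ Ideal.span {x}) hd1
    have hprime : (Ideal.span {x}).IsPrime := (Ideal.Quotient.isDomain_iff_prime _).1 hdom
    have hbot : (⊥ : Ideal A).IsPrime := by
      obtain ⟨q, hq, hle⟩ := Ideal.exists_minimalPrimes_le (bot_le : (⊥ : Ideal A) ≤ Ideal.span {x})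
      have hqp : q.IsPrime := hq.1.1
      have : q = ⊥ := by
        refine Submodule.eq_bot_of_le_smul_of_le_jacobson_bot (maximalIdeal A) _
          (IsNoetherian.noetherian q) ?_ (maximalIdeal_le_jacobson _)
        intro y hy
        obtain ⟨a, rfl⟩ := Ideal.mem_span_singleton'.1 (hle hy)
        rw [mul_comm]
        exact Submodule.smul_mem_smul hxm ((hqp.mem_or_mem hy).resolve_right (hxq q hq))
      exact this ▸ hqp
    have hdomA : IsDomain A := IsDomain.of_bot_isPrime A
    refine ⟨hdomA, ?_⟩
    have hx0 : x ≠ 0 := by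
      rintro rfl
      exact hx2 (zero_mem _)
    obtain ⟨ts, rfl⟩ := (List.map_surjective_iff.2 (Ideal.Quotient.mk_surjective
      (I := Ideal.span {x}))) rs
    have hts : ∀ t ∈ ts, t ∈ maximalIdeal A := by
      intro t ht hu
      exact hmem _ (List.mem_map_of_mem ht) (hu.map _)
    have hmem' : ∀ r ∈ x :: ts, r ∈ maximalIdeal A := by
      simp only [List.mem_cons, forall_eq_or_imp]
      exact ⟨hxm, hts⟩
    refine ⟨x :: ts, by simpa using hlen, hmem', ?_⟩
    refine IsRegular.of_isWeaklyRegular_of_mem_maximalIdeal A hmem' ?_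
    rw [isWeaklyRegular_cons_iff]
    refine ⟨IsSMulRegular.of_right_eq_zero_of_smul fun y hy => by simpa [hx0] using hy, ?_⟩
    have h5 := (isWeaklyRegular_map_algebraMap_iff (R := A) (A ⧸ Ideal.span {x})
      (A ⧸ Ideal.span {x}) ts).1 hrs.1
    have heq : Ideal.span {x} = x • (⊤ : Ideal A) := by simp [← Submodule.ideal_span_singleton_smul]
    exact ((Submodule.quotEquivOfEq _ _ heq).isWeaklyRegular_congr ts).1 h5


theorem unmixed {R : Type u} [CommRing R] [IsRegularRing R] (gs : List R)
    (hh : ∀ q : PrimeSpectrum R, Ideal.ofList gs ≤ q.asIdeal → (gs.length : ℕ∞) ≤ Order.height q)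
    (P : Ideal R) [hP : P.IsPrime] (x : R) (hx : ∀ a, a ∈ P ↔ a * x ∈ Ideal.ofList gs) :
    P.height ≤ gs.length := by
  have hIP : Ideal.ofList gs ≤ P := fun a ha => (hx a).2 (Ideal.mul_mem_right _ _ ha)
  have hreg : IsRegularLocalRing (Localization.AtPrime P) := inferInstance
  set B := Localization.AtPrime P with hB
  have hdim : ringKrullDim B = P.height :=
    IsLocalization.AtPrime.ringKrullDim_eq_height P B
  obtain ⟨d, hd⟩ := ENat.ne_top_iff_exists.1 (Ideal.height_ne_top (I := P) hP.ne_top)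
  have hdim' : ringKrullDim B = d := by
    rw [hdim, ← hd]; rfl
  obtain ⟨-, hdep⟩ := regular_aux d B hdim'
  set gs' : List B := gs.map (algebraMap R B) with hgs'
  have hmap : Ideal.ofList gs' = (Ideal.ofList gs).map (algebraMap R B) := by
    rw [hgs', Ideal.map_ofList]
  have hmem : ∀ g ∈ gs', g ∈ maximalIdeal B := by
    intro g hg
    obtain ⟨a, ha, rfl⟩ := List.mem_map.1 hg
    rw [IsLocalization.AtPrime.to_map_mem_maximal_iff B P]
    exact hIP (Ideal.subset_span ha)
  have h1 : ringKrullDim (B ⧸ Ideal.ofList gs') + (gs'.length : ℕ) ≤ ringKrullDim B := by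
    apply height_add_dim_le
    intro q hq
    have h2 : Ideal.ofList gs ≤ q.asIdeal.under R := by
      rw [hmap, Ideal.map_le_iff_le_comap] at hq
      exact hq
    have h3 := hh ⟨q.asIdeal.under R, inferInstance⟩ h2
    have h4 := IsLocalization.height_under P.primeCompl q.asIdeal
    rw [PrimeSpectrum.height_eq_orderHeight q] at h4
    rw [hgs', List.length_map, ← h4]
    exact h3.trans (PrimeSpectrum.height_eq_orderHeight ⟨q.asIdeal.under R, inferInstance⟩).ge
  rw [← Module.supportDim_quotient_eq_ringKrullDim, hdim'] at h1
  have htop : Ideal.ofList gs' • (⊤ : Submodule B B) = Ideal.ofList gs' := by simp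
  obtain ⟨k, hk, hk'⟩ := HasDepth.quot_list gs' hmem hdep (by rw [htop]; exact h1)
  have hk0 : k = 0 := by
    by_contra hne
    obtain ⟨rs, hl, hm, hr⟩ := hk'
    match rs with
    | [] => simp at hl; omega
    | y :: rs =>
      simp only [isRegular_cons_iff] at hr
      simp only [List.mem_cons, forall_eq_or_imp] at hm
      have hz : y • (Submodule.Quotient.mk (algebraMap R B x) :
          B ⧸ Ideal.ofList gs' • (⊤ : Submodule B B)) = 0 := by
        rw [← Submodule.Quotient.mk_smul, Submodule.Quotient.mk_eq_zero, htop]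
        obtain ⟨a, u, rfl⟩ := IsLocalization.exists_mk'_eq P.primeCompl y
        have ha : a ∈ P := by
          have := hm.1
          rwa [IsLocalization.AtPrime.mk'_mem_maximal_iff B P] at this
        have h6 : algebraMap R B (a * x) ∈ Ideal.ofList gs' := by
          rw [hmap]; exact Ideal.mem_map_of_mem _ ((hx a).1 ha)
        rw [smul_eq_mul, ← IsLocalization.mk'_one (M := P.primeCompl) B x,
          ← IsLocalization.mk'_mul, IsLocalization.mk'_eq_mul_mk'_one]
        exact Ideal.mul_mem_right _ _ h6
      have h0 := hr.1.right_eq_zero_of_smul hz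
      rw [Submodule.Quotient.mk_eq_zero, htop, hmap,
        IsLocalization.algebraMap_mem_map_algebraMap_iff P.primeCompl] at h0
      obtain ⟨u, hu, hux⟩ := h0
      exact hu ((hx u).2 hux)
  rw [← hd]
  have : d = gs.length := by
    rw [← hk, hk0, hgs', List.length_map, zero_add]
  rw [this]

end CMAux

namespace LatAux

/-- The monomial with a given exponent vector. -/
def mon {s : ℕ} (K : Type*) [Field K] (a : Fin s → ℕ) : MvPolynomial (Fin s) K :=
  monomial (toFs a) (1 : K)

lemma mon_add {s : ℕ} (K : Type*) [Field K] (a b : Fin s → ℕ) :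
    mon K (a + b) = mon K a * mon K b := by
  unfold mon
  rw [monomial_mul, one_mul]
  congr 2
  ext i
  simp

lemma mon_eq_prod {s : ℕ} (K : Type*) [Field K] (a : Fin s → ℕ) :
    mon K a = ∏ i, (X i : MvPolynomial (Fin s) K) ^ a i := by
  unfold mon
  rw [monomial_eq, C_1, one_mul, Finsupp.prod_fintype]
  · rfl
  · simp

lemma mon_sub_mem {s : ℕ} (K : Type*) [Field K] (𝓛 : AddSubgroup (Fin s → ℤ))
    (a b : Fin s → ℕ) (h : intVec a - intVec b ∈ 𝓛) : mon K a - mon K b ∈ latticeIdeal K 𝓛 := by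
  have h1 : mon K (fun i => ((intVec a - intVec b) i).toNat)
      - mon K (fun i => (-(intVec a - intVec b) i).toNat) ∈ latticeIdeal K 𝓛 :=
    Ideal.subset_span ⟨_, h, rfl⟩
  have h2 := Ideal.mul_mem_left _ (mon K (fun i => min (a i) (b i))) h1
  rw [mul_sub, ← mon_add, ← mon_add] at h2
  convert h2 using 3
  · funext i
    simp [intVec]
    omega
  · funext i
    simp [intVec]
    omega

/-- exponent vectors to classes modulo the lattice -/
def expHom {s : ℕ} (𝓛 : AddSubgroup (Fin s → ℤ)) : (Fin s →₀ ℕ) →+ (Fin s → ℤ) ⧸ 𝓛 :=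
  (QuotientAddGroup.mk' 𝓛).comp
    { toFun := fun m => intVec m
      map_zero' := by funext i; simp [intVec]
      map_add' := by intro a b; funext i; simp [intVec] }

/-- The map to the group algebra. -/
def phi {s : ℕ} (K : Type*) [Field K] (𝓛 : AddSubgroup (Fin s → ℤ)) :
    MvPolynomial (Fin s) K →ₐ[K] AddMonoidAlgebra K ((Fin s → ℤ) ⧸ 𝓛) :=
  AddMonoidAlgebra.mapDomainAlgHom K K (expHom 𝓛)

lemma phi_monomial {s : ℕ} (K : Type*) [Field K] (𝓛 : AddSubgroup (Fin s → ℤ))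
    (m : Fin s →₀ ℕ) (c : K) :
    phi K 𝓛 (monomial m c) = AddMonoidAlgebra.single (expHom 𝓛 m) c :=
  AddMonoidAlgebra.mapDomain_single

lemma latticeIdeal_le {s : ℕ} (K : Type*) [Field K] (𝓛 : AddSubgroup (Fin s → ℤ)) :
    latticeIdeal K 𝓛 ≤ RingHom.ker (phi K 𝓛) := by
  refine Ideal.span_le.2 ?_
  rintro _ ⟨a, ha, rfl⟩
  rw [SetLike.mem_coe, RingHom.mem_ker, map_sub, phi_monomial, phi_monomial, sub_eq_zero]
  congr 1
  refine QuotientAddGroup.eq.2 ?_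
  have : -intVec (fun i => (a i).toNat) + intVec (fun i => (-a i).toNat) = -a := by
    funext i
    simp [intVec]
    omega
  change -intVec (fun i => (a i).toNat) + intVec (fun i => (-a i).toNat) ∈ 𝓛
  rw [this]
  exact neg_mem ha

lemma ker_le {s : ℕ} (K : Type*) [Field K] (𝓛 : AddSubgroup (Fin s → ℤ)) :
    RingHom.ker (phi K 𝓛) ≤ latticeIdeal K 𝓛 := by
  classical
  let rep : ((Fin s → ℤ) ⧸ 𝓛) → (Fin s →₀ ℕ) := fun x =>
    if h : ∃ m, expHom 𝓛 m = x then h.choose else 0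
  have hrep : ∀ m, expHom 𝓛 (rep (expHom 𝓛 m)) = expHom 𝓛 m := by
    intro m
    have h : ∃ m', expHom 𝓛 m' = expHom 𝓛 m := ⟨m, rfl⟩
    simp only [rep, dif_pos h]
    exact h.choose_spec
  let psi : AddMonoidAlgebra K ((Fin s → ℤ) ⧸ 𝓛) → MvPolynomial (Fin s) K ⧸ latticeIdeal K 𝓛 :=
    fun x => Finsupp.linearCombination K
      (fun y => Ideal.Quotient.mk (latticeIdeal K 𝓛) (monomial (rep y) (1 : K))) x.coeff
  have hpsi : ∀ f, psi (phi K 𝓛 f) = Ideal.Quotient.mk (latticeIdeal K 𝓛) f := by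
    intro f
    induction f using MvPolynomial.induction_on' with
    | monomial m c =>
      rw [phi_monomial]
      simp only [psi, AddMonoidAlgebra.coeff_single, Finsupp.linearCombination_single]
      have h1 : monomial m c = c • monomial m (1 : K) := by simp [smul_monomial]
      rw [h1]
      have h2 : Ideal.Quotient.mk (latticeIdeal K 𝓛) (monomial (rep (expHom 𝓛 m)) (1 : K)) =
          Ideal.Quotient.mk (latticeIdeal K 𝓛) (monomial m (1 : K)) := by
        rw [Ideal.Quotient.eq]
        have := mon_sub_mem K 𝓛 (rep (expHom 𝓛 m)) m (by
          have h3 := QuotientAddGroup.eq.1 (hrep m).symm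
          rw [sub_eq_neg_add]
          exact h3)
        unfold mon at this
        have e1 : ∀ m : Fin s →₀ ℕ, toFs m = m := fun m => by ext i; simp
        rwa [e1, e1] at this
      rw [h2]
      rfl
    | add p q hp hq =>
      rw [map_add, map_add, ← hp, ← hq]
      simp [psi]
  intro f hf
  rw [← Ideal.Quotient.eq_zero_iff_mem, ← hpsi, (RingHom.mem_ker).1 hf]
  simp [psi]

lemma X_cancel {s : ℕ} (K : Type*) [Field K] (𝓛 : AddSubgroup (Fin s → ℤ)) (i : Fin s)
    (f : MvPolynomial (Fin s) K) (h : X i * f ∈ latticeIdeal K 𝓛) : f ∈ latticeIdeal K 𝓛 := by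
  apply ker_le
  have h1 := latticeIdeal_le K 𝓛 h
  rw [RingHom.mem_ker, map_mul] at h1
  rw [RingHom.mem_ker]
  have h2 : phi K 𝓛 (X i) = AddMonoidAlgebra.single (expHom 𝓛 (Finsupp.single i 1)) 1 :=
    phi_monomial K 𝓛 _ _
  have h3 := congrArg (fun z => AddMonoidAlgebra.single (-expHom 𝓛 (Finsupp.single i 1)) 1 * z) h1
  simp only [h2] at h3
  rw [← mul_assoc, AddMonoidAlgebra.single_mul_single, neg_add_cancel, one_mul, mul_zero,
    ← AddMonoidAlgebra.one_def, one_mul] at h3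
  exact h3

lemma nilp {G : Type*} [AddCommGroup G] (K : Type*) [Field K] [CharZero K] (g : G)
    (h : IsNilpotent (AddMonoidAlgebra.single g (1 : K) - 1)) : g = 0 := by
  by_cases hg : IsOfFinAddOrder g
  · set x : AddMonoidAlgebra K G := AddMonoidAlgebra.single g (1 : K) with hx
    set m := addOrderOf g with hm
    have hm0 : 0 < m := hg.addOrderOf_pos
    have hxm : x ^ m = 1 := by
      rw [hx, AddMonoidAlgebra.single_pow, hm, addOrderOf_nsmul_eq_zero, one_pow]
      rfl
    have h1 : (x - 1) * ∑ i ∈ Finset.range m, x ^ i = 0 := by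
      rw [mul_geom_sum, hxm, sub_self]
    have h2 : IsUnit (∑ i ∈ Finset.range m, x ^ i) := by
      have h3 : ∑ i ∈ Finset.range m, x ^ i = (∑ i ∈ Finset.range m, (x ^ i - 1)) + (m : AddMonoidAlgebra K G) := by
        simp
      rw [h3]
      have h4 : IsNilpotent (∑ i ∈ Finset.range m, (x ^ i - 1)) := by
        refine isNilpotent_sum fun i _ => ?_
        rw [← mul_geom_sum]
        exact (Commute.all _ _).isNilpotent_mul_right h
      have h5 : IsUnit (m : AddMonoidAlgebra K G) := by
        have : (m : AddMonoidAlgebra K G) = algebraMap K _ (m : K) := by simp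
        rw [this]
        exact (IsUnit.mk0 (m : K) (by exact_mod_cast hm0.ne')).map _
      exact h4.isUnit_add_right_of_commute h5 (Commute.all _ _)
    have h6 : x - 1 = 0 := h2.mul_left_eq_zero.1 h1
    rw [sub_eq_zero, hx] at h6
    have h7 := congrArg AddMonoidAlgebra.coeff h6
    rw [AddMonoidAlgebra.one_def, AddMonoidAlgebra.coeff_single,
      AddMonoidAlgebra.coeff_single] at h7
    exact Finsupp.single_left_injective one_ne_zero h7
  · exfalso
    obtain ⟨n, hn⟩ := h
    set p : Polynomial K := (Polynomial.X - Polynomial.C 1) ^ n with hp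
    have hmonic : p.Monic := (Polynomial.monic_X_sub_C 1).pow n
    have hdeg : p.natDegree = n := by
      rw [hp, Polynomial.natDegree_pow, Polynomial.natDegree_X_sub_C, mul_one]
    have h1 : Polynomial.aeval (AddMonoidAlgebra.single g (1 : K)) p = 0 := by
      rw [hp]; simpa using hn
    rw [Polynomial.aeval_eq_sum_range] at h1
    have h2 := congrArg (fun z => AddMonoidAlgebra.coeff z (n • g)) h1
    have hinj := injective_nsmul_iff_not_isOfFinAddOrder.2 hg
    simp only [AddMonoidAlgebra.single_pow, one_pow, AddMonoidAlgebra.coeff_sum,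
      AddMonoidAlgebra.coeff_smul, AddMonoidAlgebra.coeff_single, Finsupp.coe_finsetSum,
      Finset.sum_apply, Finsupp.smul_apply, AddMonoidAlgebra.coeff_zero, Finsupp.coe_zero,
      Pi.zero_apply, hdeg] at h2
    rw [Finset.sum_eq_single n] at h2
    · rw [Finsupp.single_eq_same] at h2
      have h3 := hmonic.coeff_natDegree
      rw [hdeg] at h3
      rw [h3] at h2
      simp at h2
    · intro b _ hb
      rw [Finsupp.single_eq_of_ne (fun h => hb (hinj h).symm), smul_zero]
    · simp

lemma mem_of_radical {s : ℕ} (K : Type*) [Field K] [CharZero K] (𝓛 : AddSubgroup (Fin s → ℤ))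
    (a b : Fin s → ℕ) (h : mon K a - mon K b ∈ (latticeIdeal K 𝓛).radical) :
    intVec a - intVec b ∈ 𝓛 := by
  obtain ⟨n, hn⟩ := h
  have h1 := latticeIdeal_le K 𝓛 hn
  rw [RingHom.mem_ker, map_pow, map_sub] at h1
  unfold mon at h1
  rw [phi_monomial, phi_monomial] at h1
  have h2 : IsNilpotent (AddMonoidAlgebra.single (expHom 𝓛 (toFs a) - expHom 𝓛 (toFs b)) (1 : K)
      - 1) := by
    refine ⟨n, ?_⟩
    have h3 : AddMonoidAlgebra.single (expHom 𝓛 (toFs a) - expHom 𝓛 (toFs b)) (1 : K) - 1 =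
        (AddMonoidAlgebra.single (expHom 𝓛 (toFs a)) (1 : K) -
          AddMonoidAlgebra.single (expHom 𝓛 (toFs b)) (1 : K)) *
          AddMonoidAlgebra.single (-expHom 𝓛 (toFs b)) (1 : K) := by
      rw [sub_mul, AddMonoidAlgebra.single_mul_single, AddMonoidAlgebra.single_mul_single,
        add_neg_cancel, one_mul, sub_eq_add_neg (expHom 𝓛 (toFs a)), AddMonoidAlgebra.one_def]
    rw [h3, mul_pow, h1, zero_mul]
  have h3 := sub_eq_zero.1 (nilp K _ h2)
  have h4 := QuotientAddGroup.eq.1 h3.symm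
  rw [sub_eq_neg_add]
  exact h4

lemma mon_mem_of_closure {s r : ℕ} (K : Type*) [Field K] (I : Ideal (MvPolynomial (Fin s) K))
    (hI : ∀ i f, X i * f ∈ I → f ∈ I) (a b : Fin r → Fin s → ℕ)
    (hg : ∀ j, mon K (a j) - mon K (b j) ∈ I) (v : Fin s → ℤ)
    (hv : v ∈ AddSubgroup.closure (Set.range fun j => intVec (a j) - intVec (b j))) :
    ∀ p q : Fin s → ℕ, intVec p - intVec q = v → mon K p - mon K q ∈ I := by
  have hc : ∀ (c : Fin s → ℕ) f, mon K c * f ∈ I → f ∈ I := by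
    let T : Submonoid (MvPolynomial (Fin s) K) :=
      { carrier := {m | ∀ f, m * f ∈ I → f ∈ I}
        mul_mem' := by
          intro x y hx hy f hf
          rw [mul_assoc] at hf
          exact hy _ (hx _ hf)
        one_mem' := by intro f hf; simpa using hf }
    intro c
    have : mon K c ∈ T := by
      rw [mon_eq_prod]
      exact prod_mem fun i _ => pow_mem (show X i ∈ T from hI i) _
    exact this
  induction hv using AddSubgroup.closure_induction with
  | mem v hv =>
    obtain ⟨j, rfl⟩ := hv
    intro p q h
    apply hc (b j)
    have h1 : b j + p = q + a j := by
      funext i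
      have := congrFun h i
      simp [intVec] at this ⊢
      omega
    rw [mul_sub, ← mon_add, ← mon_add, h1, add_comm (b j) q, mon_add, mon_add, ← mul_sub]
    exact Ideal.mul_mem_left _ _ (hg j)
  | zero =>
    intro p q h
    have h1 : p = q := by
      funext i
      have := congrFun h i
      simp [intVec] at this ⊢
      omega
    rw [h1, sub_self]
    exact zero_mem _
  | add v w _ _ hv hw =>
    intro p q h
    obtain ⟨c, d, hcd⟩ : ∃ c d : Fin s → ℕ, intVec c - intVec d = v :=
      ⟨fun i => (v i).toNat, fun i => (-v i).toNat, by funext i; simp [intVec]⟩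
    apply hc d
    have h1 := hv (q + c) (q + d) (by rw [← hcd]; funext i; simp [intVec])
    have h2 := hw (d + p) (q + c) (by
      rw [← hcd] at h
      funext i
      have := congrFun h i
      simp [intVec] at this ⊢
      omega)
    have h3 := add_mem h2 h1
    rw [sub_add_sub_cancel, add_comm q d, mon_add, mon_add, ← mul_sub] at h3
    exact h3
  | neg v _ hv =>
    intro p q h
    have := hv q p (by rw [← neg_sub, h, neg_neg])
    rw [← neg_sub]
    exact neg_mem this

end LatAux

theorem lattice_ideal_binomial_stci_is_ci {s r : ℕ} {K : Type*} [Field K] [CharZero K]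
    (𝓛 : AddSubgroup (Fin s → ℤ)) (L : Ideal (MvPolynomial (Fin s) K))
    (hL : L = latticeIdeal K 𝓛) (hht : idealHeight L = r)
    (g : Fin r → MvPolynomial (Fin s) K) (hg : ∀ j, IsBinomial (g j))
    (hrad : L.radical = (Ideal.span (Set.range g)).radical) :
    L = Ideal.span (Set.range g) := by
  subst hL
  choose a b hab using hg
  set I := Ideal.span (Set.range g) with hI
  have hLI : latticeIdeal K 𝓛 ≤ I.radical := hrad ▸ Ideal.le_radical
  have hIL : I ≤ (latticeIdeal K 𝓛).radical := hrad ▸ Ideal.le_radical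
  have hge : ∀ q : PrimeSpectrum (MvPolynomial (Fin s) K), latticeIdeal K 𝓛 ≤ q.asIdeal →
      (r : ℕ∞) ≤ Order.height q := by
    intro q hq
    rw [← hht]
    exact iInf₂_le q hq
  have hlist : Ideal.ofList (List.ofFn g) = I := by
    rw [hI, Ideal.ofList]
    congr 1
    ext f
    simp [List.mem_ofFn]
  -- the variables are regular modulo `I`
  have hreg : ∀ i f, X i * f ∈ I → f ∈ I := by
    intro i f hf
    by_contra hfI
    obtain ⟨P, hP, hle⟩ := exists_le_isAssociatedPrime_of_isNoetherianRing
      (MvPolynomial (Fin s) K) (Ideal.Quotient.mk I f) (by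
        intro h0; exact hfI (Ideal.Quotient.eq_zero_iff_mem.1 h0))
    obtain ⟨hPp, y, hy⟩ := isAssociatedPrime_iff.1 hP
    obtain ⟨x, rfl⟩ := Ideal.Quotient.mk_surjective y
    have hXP : X i ∈ P := by
      apply hle
      rw [Submodule.mem_colon_singleton, Submodule.mem_bot]
      exact Ideal.Quotient.eq_zero_iff_mem.2 hf
    have hx : ∀ c, c ∈ P ↔ c * x ∈ I := by
      intro c
      rw [hy, Submodule.mem_colon_singleton, Submodule.mem_bot, ← Ideal.Quotient.eq_zero_iff_mem]
      rfl
    have hIP : I ≤ P := fun c hc => (hx c).2 (Ideal.mul_mem_right _ _ hc)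
    have hLP : latticeIdeal K 𝓛 ≤ P := hLI.trans (hPp.radical_le_iff.2 hIP)
    have hPr : P.height ≤ r := by
      have := CMAux.unmixed (List.ofFn g) (by
        intro q hq
        rw [List.length_ofFn]
        rw [hlist] at hq
        exact hge q (hLI.trans (q.isPrime.radical_le_iff.2 hq))) P x (by rw [hlist]; exact hx)
      rwa [List.length_ofFn] at this
    obtain ⟨Q, hQ, hQP⟩ := Ideal.exists_minimalPrimes_le hLP
    have hQp : Q.IsPrime := hQ.1.1
    have hQr : (r : ℕ∞) ≤ Q.height := by
      have := hge ⟨Q, hQp⟩ hQ.1.2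
      exact this.trans (PrimeSpectrum.height_eq_orderHeight ⟨Q, hQp⟩).ge
    have hQP' : Q = P := by
      by_contra hne
      have := Ideal.height_strict_mono_of_isPrime_of_isPrime (lt_of_le_of_ne hQP hne)
      exact absurd (hQr.trans_lt this) (not_lt.2 hPr)
    rw [← hQP'] at hXP
    obtain ⟨z, hz, hXz⟩ := Ideal.exists_mul_mem_of_mem_minimalPrimes hQ hXP
    exact hz (LatAux.X_cancel K 𝓛 i z hXz)
  have hgI : ∀ j, LatAux.mon K (a j) - LatAux.mon K (b j) ∈ I := by
    intro j
    exact Ideal.subset_span ⟨j, hab j⟩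
  set 𝓜 := AddSubgroup.closure (Set.range fun j => intVec (a j) - intVec (b j)) with h𝓜
  have hIM : I ≤ latticeIdeal K 𝓜 := by
    rw [hI, Ideal.span_le]
    rintro _ ⟨j, rfl⟩
    rw [hab j]
    exact LatAux.mon_sub_mem K 𝓜 (a j) (b j) (AddSubgroup.subset_closure ⟨j, rfl⟩)
  apply le_antisymm
  · refine Ideal.span_le.2 ?_
    rintro _ ⟨v, hv, rfl⟩
    have h1 : LatAux.mon K (fun i => (v i).toNat) - LatAux.mon K (fun i => (-v i).toNat) ∈
        (latticeIdeal K 𝓜).radical :=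
      Ideal.radical_mono hIM (hLI (Ideal.subset_span ⟨v, hv, rfl⟩))
    exact LatAux.mon_mem_of_closure K I hreg a b hgI _ (LatAux.mem_of_radical K 𝓜 _ _ h1) _ _ rfl
  · rw [hI, Ideal.span_le]
    rintro _ ⟨j, rfl⟩
    have h1 : LatAux.mon K (a j) - LatAux.mon K (b j) ∈ (latticeIdeal K 𝓛).radical := hIL (hgI j)
    rw [hab j]
    exact LatAux.mon_sub_mem K 𝓛 (a j) (b j) (LatAux.mem_of_radical K 𝓛 _ _ h1)
end
end
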